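/- arXiv:1909.07458 — 13 statements merged into one kernel-verified Lean document; each statement's English description precedes it below -/
import Mathlib

section
/- For every proper σ-ideal I on Baire space, 𝔟(≤*_I) ≤ 𝔟(≠*_I): the least cardinality of a ≤*_I-unbounded family of functions (ℕ → ℕ) → (ℕ → ℕ) is at most the least cardinality of a ≠*_I-unbounded family. -/
open Filter Cardinal MeasureTheory

noncomputable section

/-- Baire space. -/
abbrev Baire : Type := ℕ → ℕ

/-- `x ≤* y` : eventual domination. -/
def EvLE (x y : ℕ → ℕ) : Prop := ∀ᶠ n in atTop, x n ≤ y n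

/-- `x ≠* y` : eventual non-equality. -/
def EvNE (x y : ℕ → ℕ) : Prop := ∀ᶠ n in atTop, x n ≠ y n

/-- A slalom: `s : ℕ → Finset ℕ` with `(s n).card ≤ n`. -/
def Slalom : Type := {s : ℕ → Finset ℕ // ∀ n, (s n).card ≤ n}

/-- `x ∈* s` : eventual capture by a slalom. -/
def EvIn (x : ℕ → ℕ) (s : Slalom) : Prop := ∀ᶠ n in atTop, x n ∈ s.1 n

/-- `f R_I g` : for `I`-almost all `x`, `R (f x) (g x)` holds. -/
def RelMod {Y Z : Type*} (I : Set (Set Baire)) (R : Y → Z → Prop)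
    (f : Baire → Y) (g : Baire → Z) : Prop :=
  {x : Baire | ¬ R (f x) (g x)} ∈ I

/-- `𝔟(R_I)` : least cardinality of an `R_I`-unbounded family. -/
def bMod {Y Z : Type*} (I : Set (Set Baire)) (R : Y → Z → Prop) : Cardinal :=
  sInf {c : Cardinal | ∃ A : Set (Baire → Y), #A = c ∧
    ¬ ∃ g : Baire → Z, ∀ f ∈ A, RelMod I R f g}

/-- `𝔡(R_I)` : least cardinality of an `R_I`-dominating family. -/
def dMod {Y Z : Type*} (I : Set (Set Baire)) (R : Y → Z → Prop) : Cardinal :=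
  sInf {c : Cardinal | ∃ A : Set (Baire → Z), #A = c ∧
    ∀ f : Baire → Y, ∃ g ∈ A, RelMod I R f g}

/-- A proper σ-ideal on Baire space. -/
def IsProperSigmaIdeal (I : Set (Set Baire)) : Prop :=
  ∅ ∈ I ∧ (∀ A B : Set Baire, A ⊆ B → B ∈ I → A ∈ I) ∧
    (∀ f : ℕ → Set Baire, (∀ n, f n ∈ I) → (⋃ n, f n) ∈ I) ∧
    (Set.univ : Set Baire) ∉ I


/-- for every proper σ-ideal `I`, `𝔟(≤*_I) ≤ 𝔟(≠*_I)`. -/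
theorem stmt_1 (I : Set (Set Baire)) (hI : IsProperSigmaIdeal I) :
    bMod I EvLE ≤ bMod I EvNE := by
  have hne : {c : Cardinal | ∃ A : Set (Baire → (ℕ → ℕ)), #A = c ∧
      ¬ ∃ g : Baire → (ℕ → ℕ), ∀ f ∈ A, RelMod I EvNE f g}.Nonempty := by
    refine ⟨_, Set.univ, rfl, ?_⟩
    rintro ⟨g, hg⟩
    apply hI.2.2.2
    have h := hg g (Set.mem_univ _)
    refine hI.2.1 _ _ ?_ h
    intro x _ hx
    obtain ⟨n, hn⟩ := Filter.Eventually.exists hx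
    exact hn rfl
  refine le_csInf hne ?_
  rintro c ⟨A, hc, hA⟩
  refine csInf_le' ⟨A, hc, ?_⟩
  rintro ⟨g, hg⟩
  refine hA ⟨fun x n => g x n + 1, fun f hf => ?_⟩
  refine hI.2.1 _ _ ?_ (hg f hf)
  intro x hx hle
  refine hx ?_
  refine Filter.Eventually.mono hle ?_
  intro n hn
  exact Nat.ne_of_lt (Nat.lt_succ_of_le hn)

end
end

section
/- For every proper σ-ideal I on Baire space, 𝔟(∈*_I) ≤ 𝔡(≠*_I): if a family A of functions (ℕ → ℕ) → (ℕ → ℕ) has cardinality less than 𝔟(∈*_I), then A is not ≠*_I-dominating; indeed there is a single f : (ℕ → ℕ) → (ℕ → ℕ) such that for every g ∈ A the set {x | g x n = f x n for infinitely many n} has complement in I. -/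
open Filter Cardinal MeasureTheory

noncomputable section

theorem aux_5 (I : Set (Set Baire)) (hI : IsProperSigmaIdeal I)
    (A : Set (Baire → Baire)) (hA : #A < bMod I EvIn) :
    ∃ f : Baire → Baire, ∀ g ∈ A,
        ({x : Baire | ∃ᶠ n in atTop, g x n = f x n})ᶜ ∈ I := by
  let T : (Baire → Baire) → (Baire → Baire) := fun g x n =>
    Encodable.encode ((List.range n).map (fun j => g x (Nat.pair n j)))
  have hb : ∃ h : Baire → Slalom, ∀ f ∈ T '' A, RelMod I EvIn f h := by
    by_contra hcon
    have h1 : bMod I EvIn ≤ #(T '' A) := csInf_le' ⟨T '' A, rfl, hcon⟩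
    exact absurd (h1.trans Cardinal.mk_image_le) (not_le.mpr hA)
  obtain ⟨h, hh⟩ := hb
  let f : Baire → Baire := fun x m =>
    (((Encodable.decode (α := List ℕ)
      (((h x).1 m.unpair.1).toList.getD m.unpair.2 0)).getD []).getD m.unpair.2 0)
  refine ⟨f, fun g hg => ?_⟩
  refine hI.2.1 _ _ ?_ (hh (T g) ⟨g, hg, rfl⟩)
  intro x hx hin
  apply hx
  have hin' : ∀ᶠ n in atTop, T g x n ∈ (h x).1 n := hin
  rw [Filter.eventually_atTop] at hin'
  obtain ⟨N, hN⟩ := hin'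
  show ∃ᶠ n in atTop, g x n = f x n
  rw [Filter.frequently_atTop]
  intro a
  have hm := hN (max a N) (le_max_right _ _)
  generalize hn : max a N = n at hm
  have han : a ≤ n := hn ▸ le_max_left _ _
  rw [← Finset.mem_toList] at hm
  obtain ⟨j, hj, hje⟩ := List.mem_iff_getElem.mp hm
  have hjn : j < n := by
    have := (h x).2 n
    rw [Finset.length_toList] at hj
    omega
  refine ⟨Nat.pair n j, han.trans (Nat.left_le_pair n j), ?_⟩
  simp only [f, Nat.unpair_pair]
  rw [List.getD_eq_getElem _ _ hj, hje]
  simp [T, hjn]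

/-- for every proper σ-ideal `I`, `𝔟(∈*_I) ≤ 𝔡(≠*_I)`; moreover any family of
cardinality `< 𝔟(∈*_I)` is not `≠*_I`-dominating, as witnessed by a single `f` such that for
every `g ∈ A` the set `{x | g x n = f x n for infinitely many n}` has complement in `I`. -/
theorem stmt_5 (I : Set (Set Baire)) (hI : IsProperSigmaIdeal I) :
    bMod I EvIn ≤ dMod I EvNE ∧
    ∀ A : Set (Baire → Baire), #A < bMod I EvIn →
      (¬ ∀ f : Baire → Baire, ∃ g ∈ A, RelMod I EvNE f g) ∧
      ∃ f : Baire → Baire, ∀ g ∈ A,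
        ({x : Baire | ∃ᶠ n in atTop, g x n = f x n})ᶜ ∈ I := by
  have key : ∀ A : Set (Baire → Baire), #A < bMod I EvIn →
      (¬ ∀ f : Baire → Baire, ∃ g ∈ A, RelMod I EvNE f g) := by
    intro A hA hd
    obtain ⟨f, hf⟩ := aux_5 I hI A hA
    obtain ⟨g, hg, hr⟩ := hd f
    have h1 := hf g hg
    refine hI.2.2.2 (hI.2.1 _ _ ?_ (hI.2.2.1
      (fun n => if n = 0 then {x : Baire | ¬ EvNE (f x) (g x)} else
        ({x : Baire | ∃ᶠ n in atTop, g x n = f x n})ᶜ) ?_))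
    · intro x _
      rw [Set.mem_iUnion]
      by_cases hx : EvNE (f x) (g x)
      · refine ⟨1, ?_⟩
        rw [if_neg one_ne_zero]
        intro hfr
        exact hfr (hx.mono fun n hn e => hn e.symm)
      · exact ⟨0, by simpa using hx⟩
    · intro n
      split_ifs
      · exact hr
      · exact h1
  refine ⟨?_, fun A hA => ⟨key A hA, aux_5 I hI A hA⟩⟩
  refine le_csInf ⟨_, Set.univ, rfl, fun f => ⟨fun x n => f x n + 1, trivial, ?_⟩⟩ ?_
  · refine hI.2.1 _ _ ?_ hI.1
    intro x hx
    exact hx (Filter.Eventually.of_forall fun n => by simp)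
  · rintro c ⟨A, rfl, hd⟩
    by_contra hc
    exact key A (not_le.mp hc) hd

end
end

section
/- For every proper σ-ideal I on Baire space, 𝔟(≠*_I) ≤ 𝔡(∈*_I): if a family A of functions from ℕ → ℕ to slaloms has cardinality less than 𝔟(≠*_I), then A is not ∈*_I-dominating, i.e., there is an f : (ℕ → ℕ) → (ℕ → ℕ) such that for no h ∈ A does the set {x | f x ∈* h x} have complement in I. -/
open Filter Cardinal MeasureTheory

noncomputable section

/-- Diagonal function attached to a slalom. -/
def slDiag (s : Slalom) : Baire := fun k =>
  ((Encodable.decode (α := List ℕ)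
    ((s.1 k.unpair.1).toList.getD k.unpair.2 0)).getD []).getD k.unpair.2 0

/-- Block coding. -/
def blockCode (g : Baire) : Baire := fun n =>
  Encodable.encode ((List.range n).map fun i => g (Nat.pair n i))

theorem not_evIn_of_evNE (s : Slalom) (g : Baire) (h : EvNE (slDiag s) g) :
    ¬ EvIn (blockCode g) s := by
  intro h2
  obtain ⟨N, hN⟩ := eventually_atTop.1 h
  obtain ⟨M, hM⟩ := eventually_atTop.1 h2
  set n := max N M with hn
  have hm := hM n (le_max_right _ _)
  rw [← Finset.mem_toList] at hm
  obtain ⟨i, hi, hie⟩ := List.getElem_of_mem hm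
  have hin : i < n := by
    have := s.2 n
    rw [Finset.length_toList] at hi
    omega
  apply hN (Nat.pair n i) ((le_max_left N M).trans (Nat.left_le_pair n i))
  unfold slDiag
  rw [Nat.unpair_pair]
  simp only
  rw [List.getD_eq_getElem _ _ hi, hie]
  unfold blockCode
  rw [Encodable.encodek]
  simp [hin]

theorem part2 (I : Set (Set Baire)) (hI : IsProperSigmaIdeal I)
    (A : Set (Baire → Slalom)) (hA : #A < bMod I EvNE) :
      ∃ f : Baire → Baire, ∀ h ∈ A,
        ¬ (({x : Baire | EvIn (f x) (h x)})ᶜ ∈ I) := by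
  have hlt : #((fun (h : Baire → Slalom) (x : Baire) => slDiag (h x)) '' A) < bMod I EvNE :=
    lt_of_le_of_lt mk_image_le hA
  have hex : ∃ g : Baire → Baire,
      ∀ f ∈ ((fun (h : Baire → Slalom) (x : Baire) => slDiag (h x)) '' A), RelMod I EvNE f g := by
    by_contra hne
    exact notMem_of_lt_csInf' hlt ⟨_, rfl, hne⟩
  obtain ⟨g, hg⟩ := hex
  refine ⟨fun x => blockCode (g x), fun h hh hc => ?_⟩
  have h1 := hg _ ⟨h, hh, rfl⟩
  obtain ⟨-, hsub, hun, huniv⟩ := hI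
  apply huniv
  refine hsub _ _ ?_ (hun (fun n => if n = 0 then {x | ¬ EvNE (slDiag (h x)) (g x)} else
    ({x : Baire | EvIn (blockCode (g x)) (h x)})ᶜ) ?_)
  · intro x _
    rw [Set.mem_iUnion]
    by_cases hx : EvNE (slDiag (h x)) (g x)
    · exact ⟨1, by simpa using not_evIn_of_evNE _ _ hx⟩
    · exact ⟨0, by simpa using hx⟩
  · intro n
    by_cases hn : n = 0
    · simpa [hn, RelMod] using h1
    · simpa [hn] using hc

/-- for every proper σ-ideal `I`, `𝔟(≠*_I) ≤ 𝔡(∈*_I)`; moreover any family `A` of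
slalom-valued functions of cardinality `< 𝔟(≠*_I)` is not `∈*_I`-dominating: there is an `f`
such that for no `h ∈ A` does `{x | f x ∈* h x}` have complement in `I`. -/
theorem stmt_6 (I : Set (Set Baire)) (hI : IsProperSigmaIdeal I) :
    bMod I EvNE ≤ dMod I EvIn ∧
    ∀ A : Set (Baire → Slalom), #A < bMod I EvNE →
      ∃ f : Baire → Baire, ∀ h ∈ A,
        ¬ (({x : Baire | EvIn (f x) (h x)})ᶜ ∈ I) := by
  refine ⟨?_, fun A hA => part2 I hI A hA⟩
  refine le_csInf ?_ ?_
  · refine ⟨_, Set.univ, rfl, fun f => ?_⟩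
    refine ⟨fun x => ⟨fun n => if n = 0 then ∅ else {f x n}, fun n => ?_⟩, Set.mem_univ _, ?_⟩
    · by_cases hn : n = 0
      · simp [hn]
      · simp [hn]; omega
    · unfold RelMod
      convert hI.1
      rw [Set.eq_empty_iff_forall_notMem]
      intro x hx
      apply hx
      refine eventually_atTop.2 ⟨1, fun n hn => ?_⟩
      have : n ≠ 0 := by omega
      simp [this]
  · rintro c ⟨A, rfl, hA⟩
    by_contra hlt
    obtain ⟨f, hf⟩ := part2 I hI A (not_le.1 hlt)
    obtain ⟨h, hh, hr⟩ := hA f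
    exact hf h hh hr


end
end

section
/- Let Y and Z be nonempty types, R ⊆ Y × Z a relation such that some subset of Y has no R-bound in Z, and I a collection of subsets of ℕ → ℕ that is closed under taking subsets and such that some subset of ℕ → ℕ is not in I. Then 𝔟(R_I) ≤ 𝔟(R)^{non(I)}, where the right-hand side is cardinal exponentiation with base 𝔟(R) and exponent non(I). -/
open Filter Cardinal MeasureTheory

noncomputable section

/-- `𝔟(R)` : least cardinality of an `R`-unbounded subset of `Y`. -/
def bRel {Y Z : Type*} (R : Y → Z → Prop) : Cardinal :=
  sInf {c : Cardinal | ∃ A : Set Y, #A = c ∧ ¬ ∃ z : Z, ∀ a ∈ A, R a z}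

/-- `non(I)` : least cardinality of a subset of Baire space not in `I`. -/
def nonI (I : Set (Set Baire)) : Cardinal :=
  sInf {c : Cardinal | ∃ S : Set Baire, #S = c ∧ S ∉ I}

/-- if some subset of `Y` has no `R`-bound, `I` is closed under subsets and
some subset of Baire space is not in `I`, then `𝔟(R_I) ≤ 𝔟(R) ^ non(I)`. -/
theorem stmt_9 {Y : Type u} {Z : Type v} [Nonempty Y] [Nonempty Z] (R : Y → Z → Prop)
    (hR : ∃ A : Set Y, ¬ ∃ z : Z, ∀ a ∈ A, R a z)
    (I : Set (Set Baire))
    (hIdown : ∀ A B : Set Baire, A ⊆ B → B ∈ I → A ∈ I)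
    (hIpos : ∃ S : Set Baire, S ∉ I) :
    bMod I R ≤ bRel R ^ Cardinal.lift.{u} (nonI I) := by
  classical
  have h1 : ∃ A : Set Y, #A = bRel R ∧ ¬ ∃ z : Z, ∀ a ∈ A, R a z := by
    obtain ⟨A, hA⟩ := hR
    exact csInf_mem (s := {c : Cardinal | ∃ A : Set Y, #A = c ∧ ¬ ∃ z : Z, ∀ a ∈ A, R a z})
      ⟨#A, A, rfl, hA⟩
  have h2 : ∃ S : Set Baire, #S = nonI I ∧ S ∉ I := by
    obtain ⟨S, hS⟩ := hIpos
    exact csInf_mem (s := {c : Cardinal | ∃ S : Set Baire, #S = c ∧ S ∉ I}) ⟨#S, S, rfl, hS⟩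
  obtain ⟨A, hAc, hA⟩ := h1
  obtain ⟨S, hSc, hS⟩ := h2
  let y0 : Y := Classical.arbitrary Y
  let e : (S → A) → (Baire → Y) := fun h x => if hx : x ∈ S then (h ⟨x, hx⟩ : Y) else y0
  have hle : #(Set.range e) ≤ bRel R ^ Cardinal.lift.{u} (nonI I) := by
    rw [← hAc, ← hSc]
    refine Cardinal.mk_range_le.trans ?_
    simp
  refine le_trans (csInf_le' ⟨Set.range e, rfl, ?_⟩) hle
  rintro ⟨g, hg⟩
  push Not at hA
  choose a haA haR using hA
  let h : S → A := fun x => ⟨a (g x), haA _⟩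
  have hm : e h ∈ Set.range e := Set.mem_range_self h
  refine hS (hIdown _ _ ?_ (hg (e h) hm))
  intro x hx
  simp only [Set.mem_setOf_eq, e, h, hx, dif_pos]
  exact haR _

end
end

section
/- Let Y and Z be nonempty types, R ⊆ Y × Z a relation, and I a collection of subsets of ℕ → ℕ closed under taking subsets. If 𝔟(R) = 𝔠 and non(I) = 𝔠, where 𝔠 is the cardinality of the continuum, then 𝔠⁺ ≤ 𝔟(R_I); that is, every family of at most 𝔠 many functions (ℕ → ℕ) → Y admits a g : (ℕ → ℕ) → Z with f R_I g for every member f of the family. -/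
open Filter Cardinal MeasureTheory

noncomputable section

/-- if `𝔟(R) = 𝔠` and `non(I) = 𝔠` then `𝔠⁺ ≤ 𝔟(R_I)`; that is, every family
of at most `𝔠` many functions `Baire → Y` admits an `R_I`-bound. -/
theorem stmt_10 {Y : Type u} {Z : Type v} [Nonempty Y] [Nonempty Z] (R : Y → Z → Prop)
    (I : Set (Set Baire))
    (hIdown : ∀ A B : Set Baire, A ⊆ B → B ∈ I → A ∈ I)
    (hb : bRel R = Cardinal.continuum)
    (hnon : nonI I = Cardinal.continuum) :
    Order.succ (Cardinal.continuum : Cardinal.{u}) ≤ bMod I R ∧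
    ∀ A : Set (Baire → Y), #A ≤ Cardinal.continuum →
      ∃ g : Baire → Z, ∀ f ∈ A, RelMod I R f g := by
  have hbB : ∀ B : Set Y, #B < Cardinal.continuum → ∃ z : Z, ∀ a ∈ B, R a z := by
    intro B hB
    by_contra hcon
    rw [← hb] at hB
    exact absurd hB (not_lt.mpr (csInf_le' ⟨B, rfl, hcon⟩))
  have hnS : ∀ S : Set Baire, #S < Cardinal.continuum → S ∈ I := by
    intro S hS
    by_contra hcon
    rw [← hnon] at hS
    exact absurd hS (not_lt.mpr (csInf_le' ⟨S, rfl, hcon⟩))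
  have key : ∀ A : Set (Baire → Y), #A ≤ Cardinal.continuum →
      ∃ g : Baire → Z, ∀ f ∈ A, RelMod I R f g := by
    intro A hA
    have hBaire : #Baire = Cardinal.continuum := by simp [Baire]
    obtain ⟨r, wo, hr⟩ := Cardinal.ord_eq Baire
    have hseg : ∀ y, #{x | r x y} < Cardinal.continuum := by
      intro y
      rw [← hBaire]
      have h := Ordinal.typein_lt_type r y
      rw [← hr, Cardinal.lt_ord, Ordinal.card_typein] at h
      exact h
    have hseg' : ∀ x, #{y | ¬ r x y} < Cardinal.continuum := by
      intro x
      have hsub : {y | ¬ r x y} ⊆ insert x {y | r y x} := by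
        intro y hy
        rcases trichotomous_of r x y with h | h | h
        · exact absurd h hy
        · exact Or.inl h.symm
        · exact Or.inr h
      refine (Cardinal.mk_le_mk_of_subset hsub).trans_lt ?_
      refine Cardinal.mk_insert_le.trans_lt ?_
      exact Cardinal.add_lt_of_lt Cardinal.aleph0_le_continuum (hseg x)
        (Cardinal.one_lt_aleph0.trans_le Cardinal.aleph0_le_continuum)
    rcases A.eq_empty_or_nonempty with rfl | hne
    · exact ⟨fun _ => Classical.arbitrary Z, by simp⟩
    have : Nonempty A := hne.to_subtype
    have hemb : Cardinal.lift.{0} #A ≤ Cardinal.lift.{u} #Baire := by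
      rw [hBaire]; simpa using hA
    obtain ⟨i⟩ := Cardinal.lift_mk_le'.mp hemb
    have hsur := Function.invFun_surjective i.injective
    set e : Baire → A := Function.invFun i
    have hg : ∀ x : Baire, ∃ z : Z, ∀ a ∈ (fun y => (e y).1 x) '' {y | ¬ r x y}, R a z := by
      intro x
      apply hbB
      have h1 := Cardinal.mk_image_le_lift (f := fun y => (e y).1 x) (s := {y | ¬ r x y})
      have h2 : Cardinal.lift.{u} #{y | ¬ r x y} < Cardinal.continuum := by
        rw [← Cardinal.lift_continuum.{u, 0}]
        exact Cardinal.lift_lt.mpr (hseg' x)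
      simpa using h1.trans_lt h2
    choose g hg using hg
    refine ⟨g, fun f hf => ?_⟩
    obtain ⟨y, hy⟩ := hsur ⟨f, hf⟩
    refine hIdown _ _ ?_ (hnS _ (hseg y))
    intro x hx
    by_contra hxy
    exact hx (hg x _ ⟨y, hxy, by simp only [hy]⟩)
  refine ⟨?_, key⟩
  have huniv : Set.univ ∉ I := by
    intro hu
    have : nonI I = 0 := by
      have he : {c : Cardinal | ∃ S : Set Baire, #S = c ∧ S ∉ I} = ∅ := by
        ext c
        simp only [Set.mem_setOf_eq, Set.mem_empty_iff_false, iff_false]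
        rintro ⟨S, -, hS⟩
        exact hS (hIdown _ _ (Set.subset_univ S) hu)
      rw [nonI, he, Cardinal.sInf_empty]
    exact Cardinal.continuum_ne_zero (hnon.symm.trans this)
  have hunb : ∀ z : Z, ∃ a : Y, ¬ R a z := by
    by_contra! hcon
    obtain ⟨z, hz⟩ := hcon
    have : bRel R = 0 := by
      have he : {c : Cardinal | ∃ A : Set Y, #A = c ∧ ¬ ∃ z : Z, ∀ a ∈ A, R a z} = ∅ := by
        ext c
        simp only [Set.mem_setOf_eq, Set.mem_empty_iff_false, iff_false]
        rintro ⟨S, -, hS⟩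
        exact hS ⟨z, fun a _ => hz a⟩
      rw [bRel, he, Cardinal.sInf_empty]
    exact Cardinal.continuum_ne_zero (hb.symm.trans this)
  refine le_csInf ⟨_, Set.univ, rfl, ?_⟩ ?_
  · rintro ⟨g, hg⟩
    choose a ha using hunb
    have := hg (fun x => a (g x)) trivial
    apply huniv
    refine hIdown _ _ ?_ this
    intro x _
    exact ha (g x)
  · rintro c ⟨A, rfl, hA⟩
    rw [Order.succ_le_iff]
    by_contra hlt
    exact hA (key A (not_lt.mp hlt))


end
end

section
/- Let N be the μ-null ideal, M the meager ideal, and K the ideal of subsets of ℕ → ℕ contained in a σ-compact set. Assume add(N) = 𝔠, where add(N) is the least cardinality of a family of μ-null sets whose union is not μ-null and 𝔠 is the cardinality of the continuum. Then for every ideal I ∈ {N, M, K} and every relation R ∈ {∈*, ≤*, ≠*}, both 𝔟(R_I) ≥ 𝔠⁺ and 𝔡(R_I) ≥ 𝔠⁺ hold; that is, all 18 higher-dimensional cardinal characteristics exceed the continuum. -/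
open Filter Cardinal MeasureTheory

noncomputable section

open ENNReal in
/-- `μ` is the product probability measure on `ℕ → ℕ` whose every factor gives mass
`2 ^ -(k+1)` to `k`: it is characterized by its values on basic cylinders. -/
def IsBaireProductMeasure (μ : Measure Baire) : Prop :=
  ∀ s : List ℕ, μ {x : Baire | ∀ i : Fin s.length, x i = s.get i} =
    (s.map fun k => ((2 : ℝ≥0∞) ^ (k + 1))⁻¹).prod

/-- The ideal of `μ`-null sets (in the sense of outer measure). -/
def NullIdeal (μ : Measure Baire) : Set (Set Baire) := {A : Set Baire | μ A = 0}

/-- The meager ideal on Baire space. -/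
def MeagerIdeal : Set (Set Baire) := {A : Set Baire | IsMeagre A}

/-- The ideal of subsets of Baire space contained in a σ-compact set. -/
def KIdeal : Set (Set Baire) := {A : Set Baire | ∃ K : Set Baire, IsSigmaCompact K ∧ A ⊆ K}

/-- `add(N)` : least cardinality of a family of `μ`-null sets whose union is not `μ`-null. -/
def addNull (μ : Measure Baire) : Cardinal :=
  sInf {c : Cardinal | ∃ S : Set (Set Baire), #S = c ∧ (∀ A ∈ S, μ A = 0) ∧ μ (⋃₀ S) ≠ 0}

lemma mk_Iio_small (t : (𝔠 : Cardinal.{0}).ord.ToType) : #(Set.Iio t) < 𝔠 := by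
  simpa using mk_Iio_lt t

lemma mk_baire : #Baire = 𝔠 := by
  simp [Baire]

lemma inj_choice {X : Type} (S : (𝔠 : Cardinal.{0}).ord.ToType → Set X) (hS : ∀ t, 𝔠 ≤ #(S t)) :
    ∃ x : (𝔠 : Cardinal.{0}).ord.ToType → X, Function.Injective x ∧ ∀ t, x t ∈ S t := by
  classical
  have key : ∀ (t : (𝔠 : Cardinal.{0}).ord.ToType) (ih : ∀ s, s < t → X),
      ∃ y, y ∈ S t ∧ ∀ s (h : s < t), ih s h ≠ y := by
    intro t ih
    by_contra hcon
    push Not at hcon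
    have hsub : S t ⊆ Set.range (fun s : Set.Iio t => ih s.1 s.2) := by
      intro y hy
      obtain ⟨s, h, e⟩ := hcon y hy
      exact ⟨⟨s, h⟩, e⟩
    have h1 : #(S t) ≤ #(Set.Iio t) := (mk_le_mk_of_subset hsub).trans mk_range_le
    exact absurd ((hS t).trans h1) (not_le.2 (mk_Iio_small t))
  have wf : WellFounded (fun a b : (𝔠 : Cardinal.{0}).ord.ToType => a < b) := wellFounded_lt
  let x : (𝔠 : Cardinal.{0}).ord.ToType → X := wf.fix (fun t ih => (key t ih).choose)
  have hx : ∀ t, x t ∈ S t ∧ ∀ s (h : s < t), x s ≠ x t := by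
    intro t
    have := (key t (fun s _ => x s)).choose_spec
    have e : x t = (key t (fun s _ => x s)).choose := wf.fix_eq _ t
    rw [← e] at this
    exact this
  refine ⟨x, ?_, fun t => (hx t).1⟩
  intro a b hab
  rcases lt_trichotomy a b with h | h | h
  · exact absurd hab ((hx b).2 a h)
  · exact h
  · exact absurd hab.symm ((hx a).2 b h)

lemma split (BB : Set (Set Baire)) (hBB : #BB ≤ 𝔠) (hB : ∀ B ∈ BB, 𝔠 ≤ #B) :
    ∃ h : Baire → Baire, ∀ B ∈ BB, ∀ v, ∃ x ∈ B, h x = v := by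
  classical
  rcases BB.eq_empty_or_nonempty with rfl | hne
  · exact ⟨id, by simp⟩
  have : Nonempty BB := hne.to_subtype
  have hP : #(BB × Baire) ≤ #((𝔠 : Cardinal.{0}).ord.ToType) := by
    rw [mk_ord_toType, mk_prod, mk_baire]
    simp only [lift_id]
    calc #BB * 𝔠 ≤ 𝔠 * 𝔠 := by gcongr
      _ = 𝔠 := continuum_mul_self
  obtain ⟨j⟩ := Cardinal.le_def _ _ |>.1 hP
  have : Nonempty (𝔠 : Cardinal.{0}).ord.ToType := ⟨j (Classical.arbitrary _)⟩
  let φ : (𝔠 : Cardinal.{0}).ord.ToType → BB × Baire := Function.invFun j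
  have hφ : Function.Surjective φ := Function.invFun_surjective j.injective
  obtain ⟨x, xi, hx⟩ := inj_choice (fun t => (φ t).1.1) (fun t => hB _ (φ t).1.2)
  refine ⟨fun y => (φ (Function.invFun x y)).2, ?_⟩
  intro B hBm v
  obtain ⟨t, ht⟩ := hφ (⟨B, hBm⟩, v)
  refine ⟨x t, ?_, ?_⟩
  · have := hx t
    rwa [ht] at this
  · simp only [Function.leftInverse_invFun xi t, ht]

lemma mk_measurable : #{s : Set Baire | MeasurableSet s} ≤ 𝔠 := by
  have h := MeasurableSpace.cardinal_measurableSet_le_continuum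
    (s := MeasurableSpace.countableGeneratingSet Baire)
    ((MeasurableSpace.countable_countableGeneratingSet (α := Baire)).le_aleph0.trans
      aleph0_le_continuum)
  rwa [MeasurableSpace.generateFrom_countableGeneratingSet] at h

lemma abstract_b {Y Z : Type} (I : Set (Set Baire)) (R : Y → Z → Prop)
    (hsmall : ∀ S : Set Baire, #S < 𝔠 → S ∈ I)
    (hsub : ∀ A B : Set Baire, A ⊆ B → B ∈ I → A ∈ I)
    (huniv : (Set.univ : Set Baire) ∉ I)
    (hR1 : ∀ F : Set Y, #F < 𝔠 → ∃ z, ∀ y ∈ F, R y z)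
    (hR2 : ∀ z, ∃ y, ¬ R y z) : Order.succ 𝔠 ≤ bMod I R := by
  classical
  refine le_csInf ?_ ?_
  · refine ⟨_, Set.univ, rfl, ?_⟩
    rintro ⟨g, hg⟩
    choose f hf using fun x => hR2 (g x)
    have := hg f trivial
    apply huniv
    simpa [RelMod, hf] using this
  · rintro c ⟨A, rfl, hA⟩
    rw [Order.succ_le_iff]
    by_contra hle
    push Not at hle
    apply hA
    have e1 : #Baire = #((𝔠 : Cardinal.{0}).ord.ToType) := by rw [mk_ord_toType, mk_baire]
    obtain ⟨e⟩ := Cardinal.eq.1 e1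
    rw [← mk_ord_toType 𝔠] at hle
    obtain ⟨j⟩ := Cardinal.le_def _ _ |>.1 hle
    have : ∀ x : Baire, ∃ z, ∀ f : A, j f < e x → R (f.1 x) z := by
      intro x
      obtain ⟨z, hz⟩ := hR1 ((fun f : A => f.1 x) '' (j ⁻¹' (Set.Iio (e x)))) (by
        refine lt_of_le_of_lt mk_image_le (lt_of_le_of_lt ?_ (mk_Iio_small (e x)))
        exact mk_preimage_of_injective _ _ j.injective)
      exact ⟨z, fun f hf => hz _ ⟨f, hf, rfl⟩⟩
    choose g hg using this
    refine ⟨g, fun f hf => ?_⟩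
    refine hsub _ (e ⁻¹' (Set.Iic (j ⟨f, hf⟩))) ?_ (hsmall _ ?_)
    · intro x hx
      by_contra h
      exact hx (hg x ⟨f, hf⟩ (not_le.1 h))
    · refine lt_of_le_of_lt (mk_preimage_of_injective _ _ e.injective) ?_
      rw [← Set.Iio_insert]
      refine lt_of_le_of_lt mk_insert_le ?_
      exact add_lt_of_lt aleph0_le_continuum (mk_Iio_small _)
        (one_lt_aleph0.trans_le aleph0_le_continuum)

lemma abstract_d {Y Z : Type} (I : Set (Set Baire)) (R : Y → Z → Prop)
    (hsmall : ∀ S : Set Baire, #S < 𝔠 → S ∈ I)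
    (hsub : ∀ A B : Set Baire, A ⊆ B → B ∈ I → A ∈ I)
    (hun : ∀ A B : Set Baire, A ∈ I → B ∈ I → A ∪ B ∈ I)
    (hcof : ∀ A ∈ I, ∃ B, A ⊆ B ∧ B ∈ I ∧ MeasurableSet B)
    (huniv : (Set.univ : Set Baire) ∉ I)
    (hR1 : ∀ F : Set Y, #F < 𝔠 → ∃ z, ∀ y ∈ F, R y z)
    (hR2 : ∀ z, ∃ y, ¬ R y z) : Order.succ 𝔠 ≤ dMod I R := by
  classical
  refine le_csInf ?_ ?_
  · refine ⟨_, Set.univ, rfl, ?_⟩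
    intro f
    have : ∀ x, ∃ z, R (f x) z := fun x => by
      obtain ⟨z, hz⟩ := hR1 {f x} (by simpa using (one_lt_aleph0.trans_le aleph0_le_continuum))
      exact ⟨z, hz _ rfl⟩
    choose g hg using this
    exact ⟨g, trivial, by simpa [RelMod, hg] using hsmall ∅ (by simpa using continuum_pos)⟩
  · rintro c ⟨A, rfl, hA⟩
    rw [Order.succ_le_iff]
    by_contra hle
    push Not at hle
    rw [← mk_baire] at hle
    obtain ⟨j⟩ := Cardinal.le_def _ _ |>.1 hle
    obtain ⟨h, hh⟩ := split {B | MeasurableSet B ∧ Bᶜ ∈ I}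
      ((mk_le_mk_of_subset (fun B hB => hB.1)).trans mk_measurable) (by
        rintro B ⟨-, hB⟩
        by_contra hlt
        apply huniv
        have := hun _ _ hB (hsmall B (not_le.1 hlt))
        rwa [Set.compl_union_self] at this)
    have hfib : ∀ v, h ⁻¹' {v} ∉ I := by
      intro v hv
      obtain ⟨B, hB1, hB2, hB3⟩ := hcof _ hv
      obtain ⟨x, hx, hxv⟩ := hh Bᶜ ⟨hB3.compl, by rwa [compl_compl]⟩ v
      exact hx (hB1 hxv)
    have : ∀ x, ∃ y, ∀ g : A, j g = h x → ¬ R y (g.1 x) := by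
      intro x
      by_cases hx : ∃ g : A, j g = h x
      · obtain ⟨g, hg⟩ := hx
        obtain ⟨y, hy⟩ := hR2 (g.1 x)
        refine ⟨y, fun g' hg' => ?_⟩
        rwa [j.injective (hg'.trans hg.symm)]
      · obtain ⟨z, -⟩ := hR1 ∅ (by simpa using continuum_pos)
        exact ⟨(hR2 z).choose, fun g hg => absurd ⟨g, hg⟩ hx⟩
    choose f hf using this
    obtain ⟨g, hg, hr⟩ := hA f
    apply hfib (j ⟨g, hg⟩)
    refine hsub _ _ ?_ hr
    intro x hx
    exact hf x ⟨g, hg⟩ (Eq.symm hx)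

lemma slalom_regroup (W : ℕ → ℕ) (hW0 : W 0 = 0)
    (h : ∀ F : Set (ℕ → ℕ), #F < 𝔠 → ∃ S : ℕ → Finset ℕ, (∀ m, (S m).card ≤ W m) ∧
      ∀ f ∈ F, ∀ᶠ m in atTop, f m ∈ S m) :
    ∀ F : Set (ℕ → ℕ), #F < 𝔠 → ∃ s : Slalom, ∀ f ∈ F, EvIn f s := by
  classical
  intro F hF
  let k : ℕ → ℕ := fun n => Nat.findGreatest (fun k => W k ≤ n) n
  have hk : ∀ n, W (k n) ≤ n := fun n =>
    Nat.findGreatest_spec (P := fun k => W k ≤ n) (Nat.zero_le n) (by simp [hW0])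
  have hkt : Tendsto k atTop atTop := by
    rw [tendsto_atTop]
    intro b
    filter_upwards [eventually_ge_atTop b, eventually_ge_atTop (W b)] with n h1 h2
    exact Nat.le_findGreatest h1 h2
  have hkb : ∀ n, n < k n + 1 + W (k n + 1) := by
    intro n
    by_contra hcon
    push Not at hcon
    have : k n + 1 ≤ k n := Nat.le_findGreatest (P := fun k => W k ≤ n) (by omega) (by omega)
    omega
  let code : (ℕ → ℕ) → ℕ → ℕ := fun f j =>
    Encodable.encode ((List.range (j + 1 + W (j + 1))).map f)
  obtain ⟨S, hS, hS'⟩ := h (code '' F) (lt_of_le_of_lt mk_image_le hF)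
  let dec : ℕ → ℕ → ℕ := fun n c => (((Encodable.decode c : Option (List ℕ))).getD []).getD n 0
  refine ⟨⟨fun n => (S (k n)).image (dec n), fun n =>
    Finset.card_image_le.trans ((hS _).trans (hk n))⟩, ?_⟩
  intro f hf
  have := hkt.eventually (hS' _ ⟨f, hf, rfl⟩)
  filter_upwards [this] with n hn
  refine Finset.mem_image.2 ⟨_, hn, ?_⟩
  simp only [dec, code, Encodable.encodek, Option.getD_some]
  simp [List.getD, hkb n]

lemma slalom_le (h : ∀ F : Set (ℕ → ℕ), #F < 𝔠 → ∃ s : Slalom, ∀ f ∈ F, EvIn f s) :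
    ∀ F : Set (ℕ → ℕ), #F < 𝔠 → ∃ y, ∀ f ∈ F, EvLE f y := by
  intro F hF
  obtain ⟨s, hs⟩ := h F hF
  refine ⟨fun n => (s.1 n).sup id, fun f hf => ?_⟩
  filter_upwards [hs f hf] with n hn
  exact Finset.le_sup (f := id) hn

lemma slalom_ne (h : ∀ F : Set (ℕ → ℕ), #F < 𝔠 → ∃ s : Slalom, ∀ f ∈ F, EvIn f s) :
    ∀ F : Set (ℕ → ℕ), #F < 𝔠 → ∃ y, ∀ f ∈ F, EvNE f y := by
  intro F hF
  obtain ⟨y, hy⟩ := slalom_le h F hF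
  refine ⟨fun n => y n + 1, fun f hf => ?_⟩
  filter_upwards [hy f hf] with n hn
  omega

lemma not_EvIn (s : Slalom) : ∃ y, ¬ EvIn y s := by
  choose y hy using fun n => Infinite.exists_notMem_finset (s.1 n)
  refine ⟨y, fun h => ?_⟩
  obtain ⟨n, hn⟩ := h.exists
  exact hy n hn

lemma not_EvLE (s : ℕ → ℕ) : ∃ y, ¬ EvLE y s := by
  refine ⟨fun n => s n + 1, fun h => ?_⟩
  obtain ⟨n, hn⟩ := h.exists
  exact absurd hn (Nat.not_succ_le_self _)

lemma not_EvNE (s : ℕ → ℕ) : ∃ y, ¬ EvNE y s := by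
  refine ⟨s, fun h => ?_⟩
  obtain ⟨n, hn⟩ := h.exists
  exact hn rfl

lemma small_K (h : ∀ F : Set (ℕ → ℕ), #F < 𝔠 → ∃ y, ∀ f ∈ F, EvLE f y)
    (S : Set Baire) (hS : #S < 𝔠) : S ∈ KIdeal := by
  obtain ⟨y, hy⟩ := h S hS
  refine ⟨⋃ M : ℕ, Set.Icc (0 : Baire) (fun n => max (y n) M),
    ⟨fun M => Set.Icc (0 : Baire) (fun n => max (y n) M), fun M => isCompact_Icc, rfl⟩, ?_⟩
  intro x hx
  obtain ⟨N, hN⟩ := eventually_atTop.1 (hy x hx)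
  refine Set.mem_iUnion.2 ⟨(Finset.range N).sup x, fun n => Nat.zero_le _, fun n => ?_⟩
  by_cases hn : n < N
  · exact le_max_of_le_right (Finset.le_sup (f := x) (Finset.mem_range.2 hn))
  · exact le_max_of_le_left (hN n (not_lt.1 hn))

lemma compact_nd {K : Set Baire} (hK : IsCompact K) : IsNowhereDense K := by
  classical
  rw [hK.isClosed.isNowhereDense_iff, Set.eq_empty_iff_forall_notMem]
  intro x hx
  obtain ⟨I, u, hu, hsub⟩ := isOpen_pi_iff.1 isOpen_interior x hx
  obtain ⟨n, hn⟩ := Infinite.exists_notMem_finset I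
  have hfin : ((fun z : Baire => z n) '' K).Finite :=
    (hK.image (continuous_apply n)).finite_of_discrete
  refine Set.infinite_univ (α := ℕ) (hfin.subset ?_)
  intro k _
  refine ⟨Function.update x n k, interior_subset (hsub ?_), by simp⟩
  intro i hi
  have : i ≠ n := fun e => hn (e ▸ hi)
  simpa [this] using (hu i hi).2

lemma K_sub_M {A : Set Baire} (hA : A ∈ KIdeal) : A ∈ MeagerIdeal := by
  obtain ⟨K, ⟨k, hk, rfl⟩, hAK⟩ := hA
  exact IsMeagre.mono hAK (isMeagre_iUnion fun n => (compact_nd (hk n)).isMeagre)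

lemma univ_M : (Set.univ : Set Baire) ∉ MeagerIdeal := by
  exact not_isMeagre_of_isGδ_of_dense IsGδ.univ dense_univ

lemma cof_M (A : Set Baire) (hA : A ∈ MeagerIdeal) :
    ∃ B, A ⊆ B ∧ B ∈ MeagerIdeal ∧ MeasurableSet B := by
  obtain ⟨t, ht, hG, hd⟩ := mem_residual.1 hA
  refine ⟨tᶜ, Set.subset_compl_comm.1 ht, ?_, hG.measurableSet.compl⟩
  change tᶜᶜ ∈ residual _
  rw [compl_compl]
  exact mem_residual.2 ⟨t, subset_rfl, hG, hd⟩

lemma cof_K (A : Set Baire) (hA : A ∈ KIdeal) :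
    ∃ B, A ⊆ B ∧ B ∈ KIdeal ∧ MeasurableSet B := by
  obtain ⟨K, ⟨k, hk, rfl⟩, hAK⟩ := hA
  exact ⟨_, hAK, ⟨_, ⟨k, hk, rfl⟩, subset_rfl⟩, .iUnion fun n => (hk n).measurableSet⟩

lemma union_K (A B : Set Baire) (hA : A ∈ KIdeal) (hB : B ∈ KIdeal) : A ∪ B ∈ KIdeal := by
  obtain ⟨K, ⟨k, hk, rfl⟩, hAK⟩ := hA
  obtain ⟨L, ⟨l, hl, rfl⟩, hBL⟩ := hB
  refine ⟨_, ⟨fun n => k n ∪ l n, fun n => (hk n).union (hl n), rfl⟩, ?_⟩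
  rw [Set.iUnion_union_distrib]
  exact Set.union_subset_union hAK hBL

section meas
variable {μ : Measure Baire} (hμ : IsBaireProductMeasure μ)
include hμ

lemma prob : IsProbabilityMeasure μ := ⟨by simpa using hμ []⟩

lemma nu_singleton (k : ℕ) : μ.map (fun x : Baire => x 0) {k} = ((2 : ENNReal) ^ (k + 1))⁻¹ := by
  rw [Measure.map_apply (measurable_pi_apply 0) (measurableSet_singleton k)]
  have := hμ [k]
  simp only [List.map_cons, List.map_nil, List.prod_cons, List.prod_nil, mul_one] at this
  rw [← this]
  congr 1
  ext x
  simp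

lemma map_fin (N : ℕ) : μ.map (fun (x : Baire) (i : Fin N) => x i) =
    Measure.pi (fun _ : Fin N => μ.map (fun x : Baire => x 0)) := by
  have := prob hμ
  have : IsProbabilityMeasure (μ.map (fun x : Baire => x 0)) :=
    Measure.isProbabilityMeasure_map (measurable_pi_apply 0).aemeasurable
  refine Measure.ext_of_singleton fun a => ?_
  rw [Measure.pi_singleton, Measure.map_apply (by fun_prop) (measurableSet_singleton a)]
  simp_rw [nu_singleton hμ]
  have h := hμ (List.ofFn a)
  rw [List.map_ofFn, List.prod_ofFn] at h
  simp only [Function.comp_def] at h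
  rw [← h]
  congr 1
  ext x
  simp only [Set.mem_preimage, Set.mem_singleton_iff, Set.mem_ofPred_eq, funext_iff]
  constructor
  · intro hx i
    rw [List.get_ofFn]
    exact hx (i.cast (by simp))
  · intro hx i
    simpa using hx (i.cast (by simp))

lemma cyl (B : Finset ℕ) (t : ℕ → Set ℕ) :
    μ {x | ∀ i ∈ B, x i ∈ t i} = ∏ i ∈ B, μ.map (fun x : Baire => x 0) (t i) := by
  classical
  have := prob hμ
  have : IsProbabilityMeasure (μ.map (fun x : Baire => x 0)) :=
    Measure.isProbabilityMeasure_map (measurable_pi_apply 0).aemeasurable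
  obtain ⟨N, hN⟩ : ∃ N, ∀ i ∈ B, i < N := ⟨B.sup id + 1, fun i hi =>
    Nat.lt_succ_of_le (Finset.le_sup (f := id) hi)⟩
  let B' : Finset (Fin N) := Finset.univ.filter (fun i => i.1 ∈ B)
  have h1 : {x : Baire | ∀ i ∈ B, x i ∈ t i} =
      (fun (x : Baire) (i : Fin N) => x i) ⁻¹' ((B' : Set (Fin N)).pi (fun i => t i)) := by
    ext x
    simp only [Set.mem_ofPred_eq, Set.mem_preimage, Set.mem_pi]
    constructor
    · intro h i hi
      exact h i (by simpa [B'] using hi)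
    · intro h i hi
      exact h ⟨i, hN i hi⟩ (by simpa [B'] using hi)
  rw [h1, ← Measure.map_apply (by fun_prop) (Set.to_countable _).measurableSet, map_fin hμ,
    Measure.pi_pi_finset]
  refine Finset.prod_bij (fun i _ => i.1) ?_ ?_ ?_ ?_
  · intro i hi; simpa [B'] using hi
  · intro i _ j _ h; exact Fin.ext h
  · intro i hi; exact ⟨⟨i, hN i hi⟩, by simpa [B'] using hi, rfl⟩
  · intros; rfl

lemma coord_eq (j v : ℕ) : μ {x | x j = v} = ((2 : ENNReal) ^ (v + 1))⁻¹ := by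
  have := cyl hμ {j} (fun _ => {v})
  simpa [nu_singleton hμ] using this

lemma coord_ne (B : Finset ℕ) (v : ℕ) :
    μ {x | ∀ i ∈ B, x i ≠ v} = (1 - ((2 : ENNReal) ^ (v + 1))⁻¹) ^ B.card := by
  have := prob hμ
  have : IsProbabilityMeasure (μ.map (fun x : Baire => x 0)) :=
    Measure.isProbabilityMeasure_map (measurable_pi_apply 0).aemeasurable
  have := cyl hμ B (fun _ => {v}ᶜ)
  rw [prob_compl_eq_one_sub (measurableSet_singleton v), nu_singleton hμ, Finset.prod_const] at this
  simpa using this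

lemma null_singleton (x : Baire) : μ {x} = 0 := by
  have h : ∀ n : ℕ, μ {x} ≤ (2⁻¹ : ENNReal) ^ n := by
    intro n
    calc μ {x} ≤ μ {y | ∀ i ∈ Finset.range n, y i ∈ ({x i} : Set ℕ)} :=
          measure_mono (by rintro _ rfl; simp)
      _ = _ := cyl hμ _ _
      _ ≤ ∏ i ∈ Finset.range n, (2⁻¹ : ENNReal) := by
          refine Finset.prod_le_prod' fun i _ => ?_
          rw [nu_singleton hμ, ENNReal.inv_le_inv]
          exact le_self_pow₀ (by norm_num) (by omega)
      _ = _ := by simp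
  refine le_antisymm (ge_of_tendsto' (ENNReal.tendsto_pow_atTop_nhds_zero_of_lt_one ?_) h) zero_le
  simp

lemma null_H (f : ℕ → ℕ) : μ {x | ∃ᶠ m in atTop, x (Nat.pair m (f m)) = m} = 0 := by
  have := measure_limsup_atTop_eq_zero (μ := μ) (s := fun m => {x : Baire | x (Nat.pair m (f m)) = m})
    (by
      simp_rw [coord_eq hμ]
      have : ∑' i : ℕ, ((2 : ENNReal) ^ (i + 1))⁻¹ = 1 := by
        simp_rw [ENNReal.inv_pow]
        rw [ENNReal.tsum_geometric_add_one, ENNReal.one_sub_inv_two, inv_inv, ENNReal.inv_mul_cancel] <;> simp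
      rw [this]; simp)
  refine measure_mono_null ?_ this
  intro x hx
  rw [mem_limsup_iff_frequently_mem]
  exact hx

omit hμ in
lemma bound_ev (δ : ENNReal) (hδ : 0 < δ) :
    ∀ᶠ m : ℕ in atTop, (1 - ((2 : ENNReal) ^ (m + 1))⁻¹) ^ (m * 2 ^ (m + 1)) < δ := by
  have h1 : ∀ m : ℕ, (1 - ((2 : ENNReal) ^ (m + 1))⁻¹) ^ (m * 2 ^ (m + 1)) ≤
      (ENNReal.ofReal (Real.exp (-1))) ^ m := by
    intro m
    rw [mul_comm, pow_mul]
    gcongr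
    have e : (1 - ((2 : ENNReal) ^ (m + 1))⁻¹) =
        ENNReal.ofReal (1 - 1 / ((2 ^ (m + 1) : ℕ) : ℝ)) := by
      rw [ENNReal.ofReal_sub _ (by positivity), ENNReal.ofReal_one, one_div,
        ENNReal.ofReal_inv_of_pos (by positivity), ENNReal.ofReal_natCast]
      push_cast
      rfl
    have hge : (1 : ℝ) ≤ ((2 ^ (m + 1) : ℕ) : ℝ) := by exact_mod_cast Nat.one_le_two_pow
    rw [e, ← ENNReal.ofReal_pow]
    · exact ENNReal.ofReal_le_ofReal (Real.one_sub_div_pow_le_exp_neg hge)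
    · rw [sub_nonneg, div_le_one (by positivity)]
      exact hge
  have h2 : Tendsto (fun m : ℕ => (ENNReal.ofReal (Real.exp (-1))) ^ m) atTop (nhds 0) :=
    ENNReal.tendsto_pow_atTop_nhds_zero_of_lt_one (by simp)
  filter_upwards [h2.eventually_lt_const hδ] with m hm
  exact (h1 m).trans_lt hm

omit hμ in
lemma self_supp (U : Set Baire) (hU : IsOpen U) (hpos : μ Uᶜ ≠ 0) :
    ∃ K : Set Baire, IsClosed K ∧ K ⊆ Uᶜ ∧ K.Nonempty ∧
      ∀ O, IsOpen O → (O ∩ K).Nonempty → μ (O ∩ K) ≠ 0 := by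
  classical
  let b := TopologicalSpace.countableBasis Baire
  let T : Set (Set Baire) := {O ∈ b | μ (O \ U) = 0}
  have hTc : T.Countable := (TopologicalSpace.countable_countableBasis Baire).mono (fun _ h => h.1)
  have hnull : μ (⋃₀ T \ U) = 0 := by
    rw [Set.sUnion_eq_biUnion, Set.sdiff_eq, Set.iUnion₂_inter]
    exact (measure_biUnion_null_iff hTc).2 fun O hO => hO.2
  let V := U ∪ ⋃₀ T
  have hV : IsOpen V := hU.union (isOpen_sUnion fun O hO =>
    TopologicalSpace.isOpen_of_mem_countableBasis hO.1)
  refine ⟨Vᶜ, hV.isClosed_compl, Set.compl_subset_compl.2 Set.subset_union_left, ?_, ?_⟩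
  · by_contra hne
    rw [Set.not_nonempty_iff_eq_empty] at hne
    apply hpos
    refine measure_mono_null ?_ hnull
    intro x hx
    have : x ∈ V := by
      by_contra h
      have : x ∈ Vᶜ := h
      rw [hne] at this; exact this
    exact ⟨this.resolve_left hx, hx⟩
  · rintro O hO ⟨x, hxO, hxV⟩ h0
    obtain ⟨o, hob, hxo, hoO⟩ :=
      (TopologicalSpace.isBasis_countableBasis Baire).exists_subset_of_mem_open hxO hO
    apply hxV
    refine Or.inr ⟨o, ⟨hob, ?_⟩, hxo⟩
    refine measure_mono_null (t := (O ∩ Vᶜ) ∪ (⋃₀ T \ U)) ?_ (measure_union_null h0 hnull)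
    rintro z ⟨hz, hzU⟩
    by_cases hzT : z ∈ ⋃₀ T
    · exact Or.inr ⟨hzT, hzU⟩
    · exact Or.inl ⟨hoO hz, fun h => h.elim hzU hzT⟩

lemma capture (hadd : addNull μ = 𝔠) (F : Set (ℕ → ℕ)) (hF : #F < 𝔠) :
    ∃ S : ℕ → Finset ℕ, (∀ m, (S m).card ≤ (m + 1) * (m * 2 ^ (m + 1))) ∧
      ∀ f ∈ F, ∀ᶠ m in atTop, f m ∈ S m := by
  classical
  have := prob hμ
  let H : (ℕ → ℕ) → Set Baire := fun f => {x | ∃ᶠ m in atTop, x (Nat.pair m (f m)) = m}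
  have hH : μ (⋃₀ (H '' F)) = 0 := by
    by_contra hne
    have : addNull μ ≤ #(H '' F) := csInf_le' ⟨H '' F, rfl, by
      rintro _ ⟨f, -, rfl⟩
      exact null_H hμ f, hne⟩
    rw [hadd] at this
    exact absurd (this.trans mk_image_le) (not_le.2 hF)
  obtain ⟨U, hHU, hU, hU1⟩ := Set.exists_isOpen_lt_of_lt (μ := μ) (⋃₀ (H '' F)) 1 (by rw [hH]; exact one_pos)
  have hpos : μ Uᶜ ≠ 0 := by
    rw [prob_compl_eq_one_sub hU.measurableSet]
    exact (tsub_pos_of_lt hU1).ne'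
  obtain ⟨K, hKc, hKU, hKne, hKs⟩ := self_supp U hU hpos
  let b := TopologicalSpace.countableBasis Baire
  -- index set
  let J : Set (Set Baire) := {O ∈ b | (O ∩ K).Nonempty}
  have hJc : J.Countable := (TopologicalSpace.countable_countableBasis Baire).mono (fun _ h => h.1)
  let A : Set Baire → ℕ → Set ℕ := fun O m => {i | ∀ x ∈ O ∩ K, x (Nat.pair m i) ≠ m}
  -- category
  have hcat : ∀ f ∈ F, ∃ O ∈ J, ∀ᶠ m in atTop, f m ∈ A O m := by
    intro f hf
    have : PolishSpace K := hKc.polishSpace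
    have : Nonempty K := hKne.to_subtype
    let C : ℕ → Set K := fun n => {x | ∀ m, n ≤ m → x.1 (Nat.pair m (f m)) ≠ m}
    have hC : ∀ n, IsClosed (C n) := by
      intro n
      simp only [C, Set.ofPred_forall]
      refine isClosed_iInter fun m => isClosed_iInter fun _ => ?_
      have hcont : Continuous (fun x : K => x.1 (Nat.pair m (f m))) :=
        (continuous_apply _).comp continuous_subtype_val
      exact (isClosed_discrete ({m}ᶜ : Set ℕ)).preimage hcont
    have hCu : ⋃ n, C n = Set.univ := by
      rw [Set.eq_univ_iff_forall]
      intro x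
      have hx : x.1 ∉ H f := fun hx => hKU x.2 (hHU ⟨_, ⟨f, hf, rfl⟩, hx⟩)
      have hx' : ∀ᶠ m in atTop, x.1 (Nat.pair m (f m)) ≠ m := not_frequently.1 hx
      obtain ⟨n, hn⟩ := eventually_atTop.1 hx'
      exact Set.mem_iUnion.2 ⟨n, hn⟩
    obtain ⟨n, x, hx⟩ := nonempty_interior_of_iUnion_of_closed hC hCu
    obtain ⟨O, hO, hOe⟩ := isOpen_induced_iff.1 (isOpen_interior (s := C n))
    have hxO : x.1 ∈ O := by
      have : x ∈ Subtype.val ⁻¹' O := by rw [hOe]; exact hx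
      exact this
    obtain ⟨o, hob, hxo, hoO⟩ :=
      (TopologicalSpace.isBasis_countableBasis Baire).exists_subset_of_mem_open hxO hO
    refine ⟨o, ⟨hob, x.1, hxo, x.2⟩, ?_⟩
    filter_upwards [eventually_ge_atTop n] with m hm y hy
    have hy' : (⟨y, hy.2⟩ : K) ∈ interior (C n) := by
      rw [← hOe]; exact hoO hy.1
    exact interior_subset hy' m hm
  -- size
  have hsize : ∀ O ∈ J, ∀ᶠ m in atTop, ∃ T : Finset ℕ, T.card ≤ m * 2 ^ (m + 1) ∧ A O m ⊆ T := by
    intro O hO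
    have hOpos := hKs O (TopologicalSpace.isOpen_of_mem_countableBasis hO.1) hO.2
    filter_upwards [bound_ev _ (pos_iff_ne_zero.2 hOpos)] with m hm
    have hsub : ∀ T : Finset ℕ, (T : Set ℕ) ⊆ A O m → T.card < m * 2 ^ (m + 1) := by
      intro T hT
      by_contra hcard
      push Not at hcard
      have hinj : Function.Injective (Nat.pair m) := fun a b h => (Nat.pair_eq_pair.1 h).2
      have h1 : μ (O ∩ K) ≤ μ {x | ∀ i ∈ T.image (Nat.pair m), x i ≠ m} := by
        refine measure_mono fun x hx => ?_
        intro i hi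
        obtain ⟨j, hj, rfl⟩ := Finset.mem_image.1 hi
        exact hT hj x hx
      rw [coord_ne hμ, Finset.card_image_of_injective _ hinj] at h1
      exact absurd (h1.trans (pow_le_pow_right_of_le_one' tsub_le_self hcard)) (not_le.2 hm)
    have hfin : (A O m).Finite := by
      by_contra hinf
      obtain ⟨T, hT, hTc⟩ := Set.Infinite.exists_subset_card_eq hinf (m * 2 ^ (m + 1))
      exact absurd hTc (hsub T hT).ne
    exact ⟨hfin.toFinset, (hsub _ (by simp)).le, by simp⟩
  rcases F.eq_empty_or_nonempty with rfl | ⟨f0, hf0⟩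
  · exact ⟨fun _ => ∅, by simp, by simp⟩
  have hJne : J.Nonempty := let ⟨O, hO, _⟩ := hcat f0 hf0; ⟨O, hO⟩
  obtain ⟨e, he⟩ := hJc.exists_eq_range hJne
  have heJ : ∀ j, e j ∈ J := fun j => he ▸ Set.mem_range_self j
  have : ∀ j m, ∃ T : Finset ℕ, T.card ≤ m * 2 ^ (m + 1) ∧
      ((∃ T : Finset ℕ, T.card ≤ m * 2 ^ (m + 1) ∧ A (e j) m ⊆ T) → A (e j) m ⊆ T) := by
    intro j m
    by_cases h : ∃ T : Finset ℕ, T.card ≤ m * 2 ^ (m + 1) ∧ A (e j) m ⊆ T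
    · obtain ⟨T, h1, h2⟩ := h
      exact ⟨T, h1, fun _ => h2⟩
    · exact ⟨∅, by simp, fun h' => absurd h' h⟩
  choose T hT1 hT2 using this
  refine ⟨fun m => (Finset.range (m + 1)).biUnion (fun j => T j m), fun m => ?_, ?_⟩
  · refine (Finset.card_biUnion_le_card_mul _ _ _ (fun j _ => hT1 j m)).trans ?_
    simp
  · intro f hf
    obtain ⟨O, hO, hfO⟩ := hcat f hf
    rw [he] at hO
    obtain ⟨j, rfl⟩ := hO
    filter_upwards [hfO, hsize _ (heJ j), eventually_ge_atTop j] with m h1 h2 h3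
    exact Finset.mem_biUnion.2 ⟨j, Finset.mem_range.2 (by omega), hT2 j m h2 h1⟩

end meas


/-- if `add(N) = 𝔠` then for every ideal `I ∈ {N, M, K}` and every relation
`R ∈ {∈*, ≤*, ≠*}`, both `𝔟(R_I)` and `𝔡(R_I)` are at least `𝔠⁺`. -/
theorem stmt_11 (μ : Measure Baire) (hμ : IsBaireProductMeasure μ)
    (hadd : addNull μ = Cardinal.continuum) :
    ∀ I ∈ ({NullIdeal μ, MeagerIdeal, KIdeal} : Set (Set (Set Baire))),
      (Order.succ Cardinal.continuum ≤ bMod I EvIn ∧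
        Order.succ Cardinal.continuum ≤ dMod I EvIn) ∧
      (Order.succ Cardinal.continuum ≤ bMod I EvLE ∧
        Order.succ Cardinal.continuum ≤ dMod I EvLE) ∧
      (Order.succ Cardinal.continuum ≤ bMod I EvNE ∧
        Order.succ Cardinal.continuum ≤ dMod I EvNE) := by
  have := prob hμ
  have hIn := slalom_regroup (fun m => (m + 1) * (m * 2 ^ (m + 1))) (by simp) (capture hμ hadd)
  have hLE := slalom_le hIn
  have hNE := slalom_ne hIn
  have fin : ∀ I : Set (Set Baire), (∀ S : Set Baire, #S < 𝔠 → S ∈ I) →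
      (∀ A B : Set Baire, A ⊆ B → B ∈ I → A ∈ I) →
      (∀ A B : Set Baire, A ∈ I → B ∈ I → A ∪ B ∈ I) →
      (∀ A ∈ I, ∃ B, A ⊆ B ∧ B ∈ I ∧ MeasurableSet B) →
      ((Set.univ : Set Baire) ∉ I) →
      (Order.succ Cardinal.continuum ≤ bMod I EvIn ∧
        Order.succ Cardinal.continuum ≤ dMod I EvIn) ∧
      (Order.succ Cardinal.continuum ≤ bMod I EvLE ∧
        Order.succ Cardinal.continuum ≤ dMod I EvLE) ∧
      (Order.succ Cardinal.continuum ≤ bMod I EvNE ∧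
        Order.succ Cardinal.continuum ≤ dMod I EvNE) := by
    intro I h1 h2 h3 h4 h5
    exact ⟨⟨abstract_b I _ h1 h2 h5 hIn not_EvIn, abstract_d I _ h1 h2 h3 h4 h5 hIn not_EvIn⟩,
      ⟨abstract_b I _ h1 h2 h5 hLE not_EvLE, abstract_d I _ h1 h2 h3 h4 h5 hLE not_EvLE⟩,
      ⟨abstract_b I _ h1 h2 h5 hNE not_EvNE, abstract_d I _ h1 h2 h3 h4 h5 hNE not_EvNE⟩⟩
  rintro I (rfl | rfl | rfl)
  · refine fin _ ?_ ?_ ?_ ?_ ?_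
    · intro S hS
      by_contra hne
      have h : addNull μ ≤ #((fun x : Baire => ({x} : Set Baire)) '' S) :=
        csInf_le' ⟨_, rfl, by
          rintro _ ⟨x, -, rfl⟩
          exact null_singleton hμ x, by
          rw [Set.sUnion_image, Set.biUnion_of_singleton]
          exact hne⟩
      rw [hadd] at h
      exact absurd (h.trans mk_image_le) (not_le.2 hS)
    · intro A B h hB
      exact measure_mono_null h hB
    · intro A B hA hB
      exact measure_union_null hA hB
    · intro A hA
      exact ⟨toMeasurable μ A, subset_toMeasurable _ _, (measure_toMeasurable A).trans hA,
        measurableSet_toMeasurable _ _⟩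
    · intro h
      have h' : μ Set.univ = 0 := h
      simp at h'
  · exact fin _ (fun S hS => K_sub_M (small_K hLE S hS)) (fun A B h hB => IsMeagre.mono h hB)
      (fun A B => IsMeagre.union) cof_M univ_M
  · exact fin _ (small_K hLE) (fun A B h ⟨K, hK, hBK⟩ => ⟨K, hK, h.trans hBK⟩) union_K cof_K
      (fun h => univ_M (K_sub_M h))

end
end

section
/- Suppose F : (ℕ → ℕ) → (ℕ → ℕ) is a bijection such that for every A ⊆ ℕ → ℕ, the image F '' A is μ-null if and only if A is meager, and F '' A is meager if and only if A is μ-null. Then for all types Y and Z and every relation R ⊆ Y × Z, 𝔟(R_N) = 𝔟(R_M) and 𝔡(R_N) = 𝔡(R_M), where N is the ideal of μ-null subsets of ℕ → ℕ and M is the ideal of meager subsets of ℕ → ℕ. -/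
open Filter Cardinal MeasureTheory

noncomputable section

theorem relMod_transfer {Y Z : Type*} (I J : Set (Set Baire)) (e : Baire ≃ Baire)
    (h : ∀ A : Set Baire, e '' A ∈ I ↔ A ∈ J) (R : Y → Z → Prop)
    (f : Baire → Y) (g : Baire → Z) :
    RelMod I R f g ↔ RelMod J R (f ∘ e) (g ∘ e) := by
  unfold RelMod
  rw [← h]
  have : e '' {x | ¬ R ((f ∘ e) x) ((g ∘ e) x)} = {x | ¬ R (f x) (g x)} := by
    ext x
    constructor
    · rintro ⟨y, hy, rfl⟩
      exact hy
    · intro hx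
      exact ⟨e.symm x, by simpa using hx, by simp⟩
  rw [this]

theorem bMod_transfer {Y Z : Type*} (I J : Set (Set Baire)) (e : Baire ≃ Baire)
    (h : ∀ A : Set Baire, e '' A ∈ I ↔ A ∈ J) (R : Y → Z → Prop) :
    bMod I R = bMod J R := by
  unfold bMod
  congr 1
  ext c
  let eY : (Baire → Y) ≃ (Baire → Y) := e.symm.arrowCongr (Equiv.refl Y)
  have heY : ∀ f, eY f = f ∘ e := fun f => by ext x; simp [eY]
  let eZ : (Baire → Z) ≃ (Baire → Z) := e.symm.arrowCongr (Equiv.refl Z)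
  have heZ : ∀ f, eZ f = f ∘ e := fun f => by ext x; simp [eZ]
  have key : ∀ f g, RelMod I R f g ↔ RelMod J R (eY f) (eZ g) := fun f g => by
    rw [heY, heZ]; exact relMod_transfer I J e h R f g
  constructor
  · rintro ⟨A, hA, hn⟩
    refine ⟨eY '' A, by rw [Cardinal.mk_image_eq eY.injective, hA], ?_⟩
    rintro ⟨g, hg⟩
    refine hn ⟨eZ.symm g, fun f hf => ?_⟩
    rw [key, Equiv.apply_symm_apply]
    exact hg _ ⟨f, hf, rfl⟩
  · rintro ⟨A, hA, hn⟩
    refine ⟨eY.symm '' A, by rw [Cardinal.mk_image_eq eY.symm.injective, hA], ?_⟩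
    rintro ⟨g, hg⟩
    refine hn ⟨eZ g, fun f hf => ?_⟩
    have := hg _ ⟨f, hf, rfl⟩
    rwa [key, Equiv.apply_symm_apply] at this

theorem dMod_transfer {Y Z : Type*} (I J : Set (Set Baire)) (e : Baire ≃ Baire)
    (h : ∀ A : Set Baire, e '' A ∈ I ↔ A ∈ J) (R : Y → Z → Prop) :
    dMod I R = dMod J R := by
  unfold dMod
  congr 1
  ext c
  let eY : (Baire → Y) ≃ (Baire → Y) := e.symm.arrowCongr (Equiv.refl Y)
  have heY : ∀ f, eY f = f ∘ e := fun f => by ext x; simp [eY]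
  let eZ : (Baire → Z) ≃ (Baire → Z) := e.symm.arrowCongr (Equiv.refl Z)
  have heZ : ∀ f, eZ f = f ∘ e := fun f => by ext x; simp [eZ]
  have key : ∀ f g, RelMod I R f g ↔ RelMod J R (eY f) (eZ g) := fun f g => by
    rw [heY, heZ]; exact relMod_transfer I J e h R f g
  constructor
  · rintro ⟨A, hA, hn⟩
    refine ⟨eZ '' A, by rw [Cardinal.mk_image_eq eZ.injective, hA], fun f => ?_⟩
    obtain ⟨g, hg, hfg⟩ := hn (eY.symm f)
    rw [key, Equiv.apply_symm_apply] at hfg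
    exact ⟨_, ⟨g, hg, rfl⟩, hfg⟩
  · rintro ⟨A, hA, hn⟩
    refine ⟨eZ.symm '' A, by rw [Cardinal.mk_image_eq eZ.symm.injective, hA], fun f => ?_⟩
    obtain ⟨g, hg, hfg⟩ := hn (eY f)
    refine ⟨_, ⟨g, hg, rfl⟩, ?_⟩
    rwa [key, Equiv.apply_symm_apply]

/-- if `F` is a bijection of Baire space interchanging null and meager sets
(in the image sense), then for all types `Y`, `Z` and every relation `R ⊆ Y × Z`,
`𝔟(R_N) = 𝔟(R_M)` and `𝔡(R_N) = 𝔡(R_M)`. -/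
theorem stmt_12 (μ : Measure Baire) (hμ : IsBaireProductMeasure μ)
    (F : Baire → Baire) (hF : Function.Bijective F)
    (h1 : ∀ A : Set Baire, μ (F '' A) = 0 ↔ IsMeagre A)
    (h2 : ∀ A : Set Baire, IsMeagre (F '' A) ↔ μ A = 0)
    {Y Z : Type*} (R : Y → Z → Prop) :
    bMod (NullIdeal μ) R = bMod MeagerIdeal R ∧
    dMod (NullIdeal μ) R = dMod MeagerIdeal R := by
  have h : ∀ A : Set Baire, (Equiv.ofBijective F hF) '' A ∈ NullIdeal μ ↔ A ∈ MeagerIdeal :=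
    fun A => h1 A
  exact ⟨bMod_transfer _ _ _ h R, dMod_transfer _ _ _ h R⟩

end
end

section
/- Assume add(N) = cof(N), where add(N) is the least cardinality of a family of μ-null sets whose union is not μ-null and cof(N) is the least cardinality of a family B of μ-null sets such that every μ-null set is contained in a member of B. Then for each relation R ∈ {∈*, ≤*, ≠*}: 𝔟(R_N) = 𝔟(R_M) and 𝔡(R_N) = 𝔡(R_M), where N is the ideal of μ-null subsets and M the ideal of meager subsets of ℕ → ℕ. -/
open Filter Cardinal MeasureTheory

noncomputable section

/-- `cof(N)` : least cardinality of a cofinal family of `μ`-null sets. -/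
def cofNull (μ : Measure Baire) : Cardinal :=
  sInf {c : Cardinal | ∃ B : Set (Set Baire), #B = c ∧ (∀ A ∈ B, μ A = 0) ∧
    ∀ A : Set Baire, μ A = 0 → ∃ B' ∈ B, A ⊆ B'}

def gd (σ : List ℕ) : Baire := fun i => σ.getD i 0
def cyl_s13 (σ : List ℕ) : Set Baire := PiNat.cylinder (gd σ) σ.length

lemma mem_cyl {σ : List ℕ} {x : Baire} : x ∈ cyl_s13 σ ↔ ∀ i < σ.length, x i = σ.getD i 0 := by
  simp [cyl_s13, PiNat.cylinder, gd]

lemma isOpen_cyl (σ : List ℕ) : IsOpen (cyl_s13 σ) := PiNat.isOpen_cylinder _ _ _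

lemma cyl_nonempty (σ : List ℕ) : (cyl_s13 σ).Nonempty := ⟨gd σ, PiNat.self_mem_cylinder _ _⟩

lemma cyl_append (σ τ : List ℕ) : cyl_s13 (σ ++ τ) ⊆ cyl_s13 σ := by
  intro x hx
  rw [mem_cyl] at *
  intro i hi
  rw [hx i (by simp; omega), List.getD_append _ _ _ _ hi]

lemma cyl_map (x : Baire) (n : ℕ) : cyl_s13 ((List.range n).map x) = PiNat.cylinder x n := by
  ext y
  rw [mem_cyl, PiNat.mem_cylinder_iff]
  simp only [List.length_map, List.length_range]
  refine forall₂_congr fun i hi => ?_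
  simp [List.getD, hi]

lemma exists_cyl {U : Set Baire} (hU : IsOpen U) {x : Baire} (hx : x ∈ U) (N : ℕ) :
    ∃ n, N ≤ n ∧ cyl_s13 ((List.range n).map x) ⊆ U := by
  obtain ⟨v, ⟨y, n, rfl⟩, hv, hvU⟩ := (PiNat.isTopologicalBasis_cylinders (fun _ : ℕ => ℕ)).exists_subset_of_mem_open hx hU
  refine ⟨max N n, le_max_left _ _, ?_⟩
  rw [cyl_map]
  rw [PiNat.mem_cylinder_iff_eq.1 hv |>.symm] at hvU
  exact (PiNat.cylinder_anti x (le_max_right _ _)).trans hvU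

lemma exists_ext {U : Set Baire} (hU : IsOpen U) (hd : Dense U) (σ : List ℕ) :
    ∃ t, cyl_s13 (σ ++ t) ⊆ U := by
  obtain ⟨x, hx, hxU⟩ := hd.inter_open_nonempty (cyl_s13 σ) (isOpen_cyl σ) (cyl_nonempty σ)
  obtain ⟨n, hn, hsub⟩ := exists_cyl hU hxU σ.length
  refine ⟨((List.range n).map x).drop σ.length, ?_⟩
  convert hsub using 2
  conv_rhs => rw [← List.take_append_drop σ.length ((List.range n).map x)]
  congr 1
  rw [mem_cyl] at hx
  apply List.ext_getElem
  · simp [hn]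
  · intro i h1 h2
    simp [hx i h1, h1]

lemma exists_ext_all {U : Set Baire} (hU : IsOpen U) (hd : Dense U) (m : ℕ) :
    ∃ t, ∀ σ : List ℕ, Encodable.encode σ < m → cyl_s13 (σ ++ t) ⊆ U := by
  induction m with
  | zero => exact ⟨[], by simp⟩
  | succ k ih =>
    obtain ⟨t, ht⟩ := ih
    by_cases h : ∃ σ : List ℕ, Encodable.encode σ = k
    · obtain ⟨σ, hσ⟩ := h
      obtain ⟨t', ht'⟩ := exists_ext hU hd (σ ++ t)
      refine ⟨t ++ t', fun ρ hρ => ?_⟩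
      rw [← List.append_assoc]
      rcases Nat.lt_succ_iff_lt_or_eq.1 hρ with h | h
      · exact (cyl_append _ _).trans (ht ρ h)
      · rw [← hσ] at h
        rw [Encodable.encode_injective h]
        exact ht'
    · refine ⟨t, fun ρ hρ => ?_⟩
      rcases Nat.lt_succ_iff_lt_or_eq.1 hρ with h' | h'
      · exact ht ρ h'
      · exact (h ⟨ρ, h'⟩).elim

lemma exists_growth (t : List ℕ) (m : ℕ) :
    ∃ b, ∀ σ : List ℕ, Encodable.encode σ < m → Encodable.encode (σ ++ t) < b := by
  have hf : {σ : List ℕ | Encodable.encode σ < m}.Finite :=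
    Set.Finite.preimage (Encodable.encode_injective.injOn) (Set.finite_lt_nat m)
  obtain ⟨b, hb⟩ := (hf.image fun σ => Encodable.encode (σ ++ t)).bddAbove
  exact ⟨b + 1, fun σ hσ => Nat.lt_succ_of_le (hb ⟨σ, hσ, rfl⟩)⟩

lemma meagre_seq {F : Set Baire} (hF : IsMeagre F) :
    ∃ U : ℕ → Set Baire, (∀ n, IsOpen (U n)) ∧ (∀ n, Dense (U n)) ∧ Antitone U ∧
      (⋂ n, U n) ⊆ Fᶜ := by
  obtain ⟨S, hSo, hSd, hSc, hS⟩ := mem_residual_iff.1 hF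
  have : ∃ V : ℕ → Set Baire, insert Set.univ S = Set.range V :=
    (hSc.insert _).exists_eq_range (Set.insert_nonempty _ _)
  obtain ⟨V, hV⟩ := this
  have hVo : ∀ n, IsOpen (V n) ∧ Dense (V n) := by
    intro n
    have : V n ∈ insert Set.univ S := hV ▸ Set.mem_range_self n
    rcases this with h | h
    · rw [h]; exact ⟨isOpen_univ, dense_univ⟩
    · exact ⟨hSo _ h, hSd _ h⟩
  have key : ∀ n, IsOpen (⋂ k ∈ Finset.range n, V k) ∧ Dense (⋂ k ∈ Finset.range n, V k) := by
    intro n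
    induction n with
    | zero => simp
    | succ n ih =>
      rw [Finset.range_add_one, Finset.set_biInter_insert]
      exact ⟨(hVo n).1.inter ih.1, (hVo n).2.inter_of_isOpen_right ih.2 ih.1⟩
  refine ⟨fun n => ⋂ k ∈ Finset.range n, V k, fun n => (key n).1, fun n => (key n).2, ?_, ?_⟩
  · intro a b hab
    exact Set.biInter_subset_biInter_left (by simpa using hab)
  · intro x hx
    apply hS
    intro v hv
    have : v ∈ Set.range V := hV ▸ Set.mem_insert_of_mem _ hv
    obtain ⟨k, rfl⟩ := this
    have := Set.mem_iInter.1 hx (k + 1)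
    simp only [Set.mem_iInter, Finset.mem_range] at this
    exact this k (Nat.lt_succ_self k)

/-- iterated positions -/
def pos (g : ℕ → ℕ) (n : ℕ) : ℕ → ℕ
  | 0 => n
  | j + 1 => max (pos g n j) (g (pos g n j))

lemma le_pos (g : ℕ → ℕ) (n j : ℕ) : n ≤ pos g n j := by
  induction j with
  | zero => exact le_rfl
  | succ j ih => exact ih.trans (le_max_left _ _)

open Classical in
def xs (g : ℕ → ℕ) (S : ℕ → Finset ℕ) (n j : ℕ) : List ℕ :=
  let t := ((Encodable.decode ((S n).toList.getD j 0) : Option (List (List ℕ))).getD []).getD j []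
  if ∀ σ : List ℕ, Encodable.encode σ < pos g n j → Encodable.encode (σ ++ t) < pos g n (j+1)
  then t else []

def ww (g : ℕ → ℕ) (S : ℕ → Finset ℕ) (n : ℕ) (σ : List ℕ) : ℕ → List ℕ
  | 0 => σ
  | j + 1 => ww g S n σ j ++ xs g S n j

lemma xs_valid (g : ℕ → ℕ) (S : ℕ → Finset ℕ) (n j : ℕ) (σ : List ℕ)
    (h : Encodable.encode σ < pos g n j) :
    Encodable.encode (σ ++ xs g S n j) < pos g n (j+1) := by
  unfold xs
  dsimp only
  split_ifs with h'
  · exact h' σ h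
  · rw [List.append_nil]; exact h.trans_le (le_max_left _ _)

lemma ww_valid (g : ℕ → ℕ) (S : ℕ → Finset ℕ) (n j : ℕ) (σ : List ℕ)
    (h : Encodable.encode σ < n) :
    Encodable.encode (ww g S n σ j) < pos g n j := by
  induction j with
  | zero => exact h
  | succ j ih => exact xs_valid _ _ _ _ _ ih

lemma ww_anti (g : ℕ → ℕ) (S : ℕ → Finset ℕ) (n : ℕ) (σ : List ℕ) :
    Antitone fun j => cyl_s13 (ww g S n σ j) :=
  antitone_nat_of_succ_le fun _ => cyl_append _ _

/-- meager set from `g` and `S` -/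
def MM (h : ℕ → ℕ) (g : ℕ → ℕ) (S : ℕ → Finset ℕ) : Set Baire :=
  (⋂ k : ℕ, ⋃ n ≥ k, ⋃ σ : List ℕ, ⋃ _ : Encodable.encode σ < n, cyl_s13 (ww g S n σ (h n)))ᶜ

lemma MM_meagre (h g : ℕ → ℕ) (S : ℕ → Finset ℕ) : IsMeagre (MM h g S) := by
  unfold IsMeagre MM
  rw [compl_compl]
  refine countable_iInter_mem.2 fun k => residual_of_dense_open ?_ ?_
  · exact isOpen_biUnion fun n _ => isOpen_iUnion fun σ => isOpen_iUnion fun _ => isOpen_cyl _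
  · rw [dense_iff_inter_open]
    rintro V hV ⟨x, hx⟩
    obtain ⟨n, -, hn⟩ := exists_cyl hV hx 0
    set σ := (List.range n).map x
    let N := max k (Encodable.encode σ + 1)
    obtain ⟨y, hy⟩ := cyl_nonempty (ww g S N σ (h N))
    refine ⟨y, hn ((ww_anti g S N σ (Nat.zero_le _)) hy), ?_⟩
    simp only [Set.mem_iUnion]
    exact ⟨N, le_max_left _ _, σ, Nat.lt_of_succ_le (le_max_right _ _), hy⟩

lemma L2 (h : ℕ → ℕ) {F : Set Baire} (hF : IsMeagre F) :
    ∃ G : ℕ → ℕ, ∀ g : ℕ → ℕ, (∀ᶠ n in atTop, G n ≤ g n) →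
      ∃ f : ℕ → ℕ, ∀ S : ℕ → Finset ℕ, (∀ n, (S n).card ≤ h n) → (∀ᶠ n in atTop, f n ∈ S n) →
        F ⊆ MM h g S := by
  obtain ⟨U, hUo, hUd, hUa, hU⟩ := meagre_seq hF
  choose t ht using fun m => exists_ext_all (hUo m) (hUd m) m
  choose G hG using fun m => exists_growth (t m) m
  refine ⟨G, fun g hg => ⟨fun n => Encodable.encode ((List.range (h n)).map fun j => t (pos g n j)), fun S hS hfS => ?_⟩⟩
  unfold MM
  rw [Set.subset_compl_comm]
  refine Set.Subset.trans (fun x hx => ?_) hU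
  obtain ⟨N, hN⟩ := eventually_atTop.1 (hg.and hfS)
  refine Set.mem_iInter.2 fun k => ?_
  have := Set.mem_iInter.1 hx (max k N)
  simp only [Set.mem_iUnion] at this
  obtain ⟨n, hn, σ, hσ, hxc⟩ := this
  have hkn : k ≤ n := (le_max_left _ _).trans hn
  have hNn : N ≤ n := (le_max_right _ _).trans hn
  have hmem := (hN n hNn).2
  rw [← Finset.mem_toList] at hmem
  obtain ⟨j, hj, hje⟩ := List.getElem_of_mem hmem
  have hjh : j < h n := by
    have := hS n
    rw [Finset.length_toList] at hj
    omega
  have hxs : xs g S n j = t (pos g n j) := by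
    unfold xs
    have e1 : (S n).toList.getD j 0 = Encodable.encode ((List.range (h n)).map fun j => t (pos g n j)) := by
      rw [List.getD_eq_getElem _ _ hj]; exact hje
    have e2 : ((Encodable.decode ((S n).toList.getD j 0) : Option (List (List ℕ))).getD []).getD j [] = t (pos g n j) := by
      rw [e1, Encodable.encodek]
      simp [List.getD, hjh]
    dsimp only
    rw [e2, if_pos]
    intro σ hσ
    refine (hG _ _ hσ).trans_le (le_trans ?_ (le_max_right _ _))
    exact (hN _ (hNn.trans (le_pos _ _ _))).1
  have h1 : x ∈ cyl_s13 (ww g S n σ (j+1)) := ww_anti g S n σ hjh hxc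
  have h2 : x ∈ U (pos g n j) := by
    apply ht (pos g n j) (ww g S n σ j) (ww_valid _ _ _ _ _ hσ)
    rw [← hxs]; exact h1
  exact hUa (hkn.trans (le_pos _ _ _)) h2

/-- transfinite injection -/
lemma exists_inj {α : Type} (P : α → Set α) (hP : ∀ a, #(P a) = #α) :
    ∃ s : α → α, Function.Injective s ∧ ∀ a, s a ∈ P a := by
  obtain ⟨r, hr, hor⟩ := Cardinal.exists_ord_eq α
  have hlt : ∀ a, #{b | r b a} < #α := by
    intro a
    have := Cardinal.card_typein_lt a hor
    exact this
  have hex : ∀ (a : α) (F : (b : α) → r b a → α), ∃ c ∈ P a, ∀ b (hb : r b a), F b hb ≠ c := by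
    intro a F
    by_contra! hcon
    have : P a ⊆ Set.range (fun b : {b | r b a} => F b.1 b.2) := by
      intro c hc
      obtain ⟨b, hb, h⟩ := hcon c hc
      exact ⟨⟨b, hb⟩, h⟩
    have h1 := (Cardinal.mk_le_mk_of_subset this).trans Cardinal.mk_range_le
    rw [hP] at h1
    exact absurd (hlt a) (not_lt.2 h1)
  choose C hC1 hC2 using hex
  let s : α → α := (hr.wf).fix C
  have hs : ∀ a, s a = C a (fun b _ => s b) := fun a => WellFounded.fix_eq _ _ _
  have hne : ∀ a b, r b a → s b ≠ s a := by
    intro a b hb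
    rw [hs a]
    exact hC2 a (fun b _ => s b) b hb
  refine ⟨s, ?_, fun a => by rw [hs a]; exact hC1 _ _⟩
  intro a b hab
  rcases trichotomous_of r a b with h | h | h
  · exact (hne _ _ h hab).elim
  · exact h
  · exact (hne _ _ h hab.symm).elim

section meas
open scoped ENNReal

def geo : Measure ℕ := Measure.sum fun k => ((2:ℝ≥0∞)^(k+1))⁻¹ • Measure.dirac k

lemma geo_singleton (k : ℕ) : geo {k} = ((2:ℝ≥0∞)^(k+1))⁻¹ := by
  rw [geo, Measure.sum_apply _ (measurableSet_singleton k), tsum_eq_single k]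
  · simp
  · intro b hb
    simp [hb]

lemma two_half (m : ℕ) : ((2:ℝ≥0∞)^(m+1))⁻¹ + ((2:ℝ≥0∞)^(m+1))⁻¹ = ((2:ℝ≥0∞)^m)⁻¹ := by
  rw [pow_succ, ENNReal.mul_inv (Or.inr ENNReal.ofNat_ne_top) (Or.inr two_ne_zero), ← mul_add, ENNReal.inv_two_add_inv_two, mul_one]

lemma geo_univ : geo Set.univ = 1 := by
  rw [geo, Measure.sum_apply _ MeasurableSet.univ]
  simp only [Measure.smul_apply, measure_univ, smul_eq_mul, mul_one]
  have := ENNReal.tsum_geometric_add_one (2:ℝ≥0∞)⁻¹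
  simp only [ENNReal.inv_pow] at this ⊢
  rw [this, ENNReal.one_sub_inv_two, inv_inv]
  exact ENNReal.inv_mul_cancel two_ne_zero ENNReal.ofNat_ne_top

instance : IsProbabilityMeasure geo := ⟨geo_univ⟩

lemma geo_Iio (m : ℕ) : geo (Set.Iio m) + ((2:ℝ≥0∞)^m)⁻¹ = 1 := by
  induction m with
  | zero => simp
  | succ m ih =>
    have : Set.Iio (m+1) = Set.Iio m ∪ {m} := by
      ext k
      simp only [Set.mem_Iio, Set.mem_union, Set.mem_singleton_iff]
      omega
    rw [this, measure_union (by simp) (measurableSet_singleton m), geo_singleton, add_assoc,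
      two_half, ih]

lemma geo_Ici (m : ℕ) : geo (Set.Ici m) = ((2:ℝ≥0∞)^m)⁻¹ := by
  have h := geo_Iio m
  have h2 : geo (Set.Iio m) + geo (Set.Ici m) = 1 := by
    rw [← geo_univ, ← Set.compl_Iio]
    exact measure_add_measure_compl measurableSet_Iio
  rw [← h] at h2
  exact (ENNReal.add_right_inj (measure_ne_top _ _)).1 h2

lemma prod_list_aux (f : ℕ → ℝ≥0∞) (σ : List ℕ) :
    ∏ i ∈ Finset.range σ.length, f (σ.getD i 0) = (σ.map f).prod := by
  induction σ with
  | nil => simp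
  | cons a l ih =>
    rw [List.length_cons, Finset.prod_range_succ']
    simp only [List.getD_cons_succ, ih, List.getD_cons_zero, List.map_cons, List.prod_cons]
    rw [mul_comm]

def PP : Measure Baire := Measure.infinitePi fun _ => geo

instance : IsProbabilityMeasure PP := by unfold PP; infer_instance

lemma PP_cyl (σ : List ℕ) : PP (cyl_s13 σ) = (σ.map fun k => ((2 : ℝ≥0∞) ^ (k + 1))⁻¹).prod := by
  have : cyl_s13 σ = (↑(Finset.range σ.length) : Set ℕ).pi fun i => {σ.getD i 0} := by
    ext x; rw [mem_cyl]; simp [Set.mem_pi]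
  rw [this, PP, Measure.infinitePi_pi _ (fun i _ => measurableSet_singleton _)]
  simp only [geo_singleton]
  exact prod_list_aux (fun k => ((2:ℝ≥0∞)^(k+1))⁻¹) σ

lemma eq_PP {μ : Measure Baire} (hμ : IsBaireProductMeasure μ) : μ = PP := by
  have hc : ∀ σ, μ (cyl_s13 σ) = PP (cyl_s13 σ) := by
    intro σ
    rw [PP_cyl, ← hμ σ]
    congr 1
    ext x
    rw [mem_cyl]
    constructor
    · intro h i
      rw [h i i.2, List.getD_eq_getElem _ _ i.2]; rfl
    · intro h i hi
      rw [List.getD_eq_getElem _ _ hi]; exact h ⟨i, hi⟩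
  have huniv : cyl_s13 [] = Set.univ := by ext x; simp [mem_cyl]
  have hu : μ Set.univ = PP Set.univ := by rw [← huniv, hc]
  have : IsFiniteMeasure μ := ⟨by rw [hu]; exact measure_lt_top _ _⟩
  refine ext_of_generate_finite {s | ∃ (x : Baire) (n : ℕ), s = PiNat.cylinder x n} ?_ ?_ ?_ hu
  · rw [← (PiNat.isTopologicalBasis_cylinders (fun _ : ℕ => ℕ)).borel_eq_generateFrom]
    exact BorelSpace.measurable_eq
  · rintro _ ⟨x, n, rfl⟩ _ ⟨y, m, rfl⟩ ⟨z, hz1, hz2⟩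
    refine ⟨z, max n m, ?_⟩
    rw [← PiNat.mem_cylinder_iff_eq.1 hz1, ← PiNat.mem_cylinder_iff_eq.1 hz2]
    ext w
    simp only [Set.mem_inter_iff, PiNat.mem_cylinder_iff, lt_max_iff]
    constructor
    · rintro ⟨h1, h2⟩ i (h | h)
      · exact h1 i h
      · exact h2 i h
    · exact fun h => ⟨fun i hi => h i (Or.inl hi), fun i hi => h i (Or.inr hi)⟩
  · rintro _ ⟨x, n, rfl⟩
    rw [← cyl_map, hc]

lemma PP_box (E : Finset ℕ) (T : Set ℕ) : PP {x | ∀ e ∈ E, x e ∈ T} = geo T ^ E.card := by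
  have : {x : Baire | ∀ e ∈ E, x e ∈ T} = (↑E : Set ℕ).pi fun _ => T := by
    ext x; simp [Set.mem_pi]
  rw [this, PP, Measure.infinitePi_pi _ (fun i _ => MeasurableSet.of_discrete)]
  simp

def Nf (f : ℕ → ℕ) : Set Baire := {x | ∃ᶠ m in atTop, m ≤ x (Nat.pair m (f m))}

lemma Nf_null (f : ℕ → ℕ) : PP (Nf f) = 0 := by
  apply measure_setOfPred_frequently_eq_zero
  have : ∀ m, PP {x : Baire | m ≤ x (Nat.pair m (f m))} = (2:ℝ≥0∞)⁻¹ ^ m := by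
    intro m
    have := PP_box {Nat.pair m (f m)} (Set.Ici m)
    simp only [Finset.mem_singleton, forall_eq, Set.mem_Ici, Finset.card_singleton, pow_one, geo_Ici] at this
    rw [this, ENNReal.inv_pow]
  simp only [this]
  rw [ENNReal.tsum_geometric_two]
  exact ENNReal.ofNat_ne_top

lemma bern_aux (δ : ℝ≥0∞) (n : ℕ) : 1 + (n : ℝ≥0∞) * δ ≤ (1 + δ) ^ n := by
  induction n with
  | zero => simp
  | succ n ih =>
    calc 1 + ((n + 1 : ℕ) : ℝ≥0∞) * δ ≤ (1 + (n : ℝ≥0∞) * δ) * (1 + δ) := by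
          have : (1 + (n : ℝ≥0∞) * δ) * (1 + δ) = 1 + ((n + 1 : ℕ) : ℝ≥0∞) * δ + n * δ * δ := by
            push_cast; ring
          rw [this]; exact le_self_add
      _ ≤ (1 + δ) ^ (n + 1) := by rw [pow_succ]; gcongr

lemma bern (m : ℕ) : geo (Set.Iio m) ^ (m * 2 ^ m) ≤ ((m + 1 : ℕ) : ℝ≥0∞)⁻¹ := by
  set a := geo (Set.Iio m)
  set δ := ((2:ℝ≥0∞)^m)⁻¹ with hδ
  have h : a + δ = 1 := geo_Iio m
  have ha : a ≤ 1 := by rw [← h]; exact le_self_add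
  have h1 : a * (1 + δ) ≤ 1 := by
    rw [mul_add, mul_one]
    calc a + a * δ ≤ a + 1 * δ := by gcongr
      _ = 1 := by rw [one_mul, h]
  have h2 : 1 + ((m * 2 ^ m : ℕ) : ℝ≥0∞) * δ ≤ (1 + δ) ^ (m * 2 ^ m) :=
    bern_aux δ _
  have h3 : ((m * 2 ^ m : ℕ) : ℝ≥0∞) * δ = m := by
    push_cast
    rw [hδ, mul_assoc, ENNReal.mul_inv_cancel (by simp) (by simp), mul_one]
  rw [h3] at h2
  rw [ENNReal.le_inv_iff_mul_le]
  calc a ^ (m * 2 ^ m) * ((m + 1 : ℕ) : ℝ≥0∞) ≤ a ^ (m * 2 ^ m) * (1 + δ) ^ (m * 2 ^ m) := by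
        gcongr; push_cast; rwa [add_comm]
    _ = (a * (1 + δ)) ^ (m * 2 ^ m) := (mul_pow _ _ _).symm
    _ ≤ 1 := pow_le_one₀ (zero_le) h1

lemma exists_K {G : Set Baire} (hG : PP G = 0) : ∃ K : Set Baire, IsClosed K ∧ K ⊆ Gᶜ ∧ K.Nonempty ∧
    ∀ U, IsOpen U → (K ∩ U).Nonempty → 0 < PP (K ∩ U) := by
  have h1 : PP (toMeasurable PP G)ᶜ = 1 := by
    rw [prob_compl_eq_one_iff (measurableSet_toMeasurable _ _), measure_toMeasurable, hG]
  obtain ⟨K0, hK0, hc, hpos⟩ := (measurableSet_toMeasurable PP G).compl.exists_lt_isClosed_of_ne_top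
    (μ := PP) (measure_ne_top _ _) (r := 0) (by rw [h1]; exact one_pos)
  let ν := PP.restrict K0
  have hν : ν ≠ 0 := by
    intro h
    have : ν Set.univ = 0 := by rw [h]; rfl
    rw [Measure.restrict_apply_univ] at this
    exact hpos.ne' this
  have hsub : ν.support ⊆ K0 :=
    Measure.support_subset_of_isClosed hc (ae_restrict_mem hc.measurableSet)
  refine ⟨ν.support, Measure.isClosed_support, ?_, Measure.nonempty_support hν, ?_⟩
  · refine hsub.trans (hK0.trans ?_)
    exact Set.compl_subset_compl.2 (subset_toMeasurable _ _)
  · rintro U hU ⟨x, hx, hxU⟩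
    have := (Measure.mem_support_iff_forall x).1 hx U (hU.mem_nhds hxU)
    have h2 : ν U ≤ ν (ν.support ∩ U) := by
      apply measure_mono_ae
      filter_upwards [Measure.support_mem_ae (μ := ν)] with y hy hyU
      exact ⟨hy, hyU⟩
    refine (this.trans_le h2).trans_le ?_
    exact Measure.restrict_apply_le _ _

def hh (m : ℕ) : ℕ := (m + 1) * (m * 2 ^ m)

lemma L1 {G : Set Baire} (hG : PP G = 0) : ∃ S : ℕ → Finset ℕ, (∀ m, (S m).card ≤ hh m) ∧
    ∀ f, Nf f ⊆ G → ∀ᶠ m in atTop, f m ∈ S m := by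
  classical
  obtain ⟨K, hKc, hKG, hKne, hKpos⟩ := exists_K hG
  let Z : List ℕ → ℕ → Set ℕ := fun σ m => {k | ∀ x ∈ K ∩ cyl_s13 σ, x (Nat.pair m k) < m}
  have hA : ∀ σ, (K ∩ cyl_s13 σ).Nonempty → ∀ᶠ m in atTop, (Z σ m).Finite ∧ (Z σ m).ncard ≤ m * 2 ^ m := by
    intro σ hσ
    have hp := hKpos _ (isOpen_cyl σ) hσ
    have ht := (tendsto_add_atTop_nat 1).eventually (ENNReal.tendsto_inv_nat_nhds_zero.eventually_lt_const hp)
    filter_upwards [ht] with m hm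
    have key : ∀ T : Finset ℕ, ↑T ⊆ Z σ m → T.card ≠ m * 2 ^ m := by
      intro T hT hcard
      have h1 : K ∩ cyl_s13 σ ⊆ {x | ∀ e ∈ T.image (Nat.pair m), x e ∈ Set.Iio m} := by
        intro x hx e he
        obtain ⟨k, hk, rfl⟩ := Finset.mem_image.1 he
        exact hT hk x hx
      have h2 := measure_mono (μ := PP) h1
      rw [PP_box, Finset.card_image_of_injective, hcard] at h2
      · exact absurd (h2.trans (bern m)) (not_le.2 hm)
      · intro a b hab
        exact (Nat.pair_eq_pair.1 hab).2
    have hfin : (Z σ m).Finite := by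
      by_contra hinf
      obtain ⟨T, hT, hc⟩ := Set.Infinite.exists_subset_card_eq hinf (m * 2 ^ m)
      exact key T hT hc
    refine ⟨hfin, ?_⟩
    by_contra! hlt
    rw [Set.ncard_eq_toFinset_card _ hfin] at hlt
    obtain ⟨T, hT, hc⟩ := Finset.exists_subset_card_eq hlt.le
    exact key T (fun k hk => hfin.mem_toFinset.1 (hT hk)) hc
  let S' : List ℕ → ℕ → Finset ℕ := fun σ m =>
    if h : (Z σ m).Finite ∧ (Z σ m).ncard ≤ m * 2 ^ m then h.1.toFinset else ∅
  have hS' : ∀ σ m, (S' σ m).card ≤ m * 2 ^ m := by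
    intro σ m
    simp only [S']
    split_ifs with h
    · rw [← Set.ncard_eq_toFinset_card _ h.1]; exact h.2
    · simp
  refine ⟨fun m => (Finset.range (m+1)).biUnion fun i =>
    S' ((Encodable.decode i : Option (List ℕ)).getD []) m, fun m => ?_, fun f hf => ?_⟩
  · refine (Finset.card_biUnion_le_card_mul _ _ (m * 2 ^ m) fun i _ => hS' _ _).trans ?_
    rw [Finset.card_range, hh]
  · have hB : ∃ σ N, (K ∩ cyl_s13 σ).Nonempty ∧ ∀ m ≥ N, f m ∈ Z σ m := by
      have := hKc.polishSpace
      have := hKne.to_subtype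
      let C : ℕ → Set K := fun n => {x | ∀ m ≥ n, x.1 (Nat.pair m (f m)) < m}
      have hC : ∀ n, IsClosed (C n) := by
        intro n
        have : C n = ⋂ m ≥ n, {x : K | x.1 (Nat.pair m (f m)) < m} := by
          ext x; simp [C]
        rw [this]
        refine isClosed_biInter fun m _ => ?_
        have hcont : Continuous fun x : K => x.1 (Nat.pair m (f m)) :=
          (continuous_apply _).comp continuous_subtype_val
        exact (isClosed_discrete (Set.Iio m)).preimage hcont
      have hU : ⋃ n, C n = Set.univ := by
        rw [Set.eq_univ_iff_forall]
        intro x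
        have hx : x.1 ∉ Nf f := fun h => hKG x.2 (hf h)
        simp only [Nf, Set.mem_ofPred_eq, not_frequently, not_le] at hx
        obtain ⟨n, hn⟩ := eventually_atTop.1 hx
        exact Set.mem_iUnion.2 ⟨n, hn⟩
      obtain ⟨n, ⟨x, hx⟩⟩ := nonempty_interior_of_iUnion_of_closed hC hU
      obtain ⟨V, hV, hVi⟩ := isOpen_induced_iff.1 (isOpen_interior (s := C n))
      have hxV : x.1 ∈ V := by
        have : x ∈ Subtype.val ⁻¹' V := by rw [hVi]; exact hx
        exact this
      obtain ⟨k, -, hk⟩ := exists_cyl hV hxV 0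
      refine ⟨(List.range k).map x.1, n, ⟨x.1, x.2, ?_⟩, fun m hm y hy => ?_⟩
      · rw [cyl_map]; exact PiNat.self_mem_cylinder _ _
      · have : (⟨y, hy.1⟩ : K) ∈ Subtype.val ⁻¹' V := hk hy.2
        rw [hVi] at this
        exact interior_subset this m hm
    obtain ⟨σ, N, hne, hN⟩ := hB
    filter_upwards [hA σ hne, eventually_ge_atTop N, eventually_ge_atTop (Encodable.encode σ)] with m h1 h2 h3
    refine Finset.mem_biUnion.2 ⟨Encodable.encode σ, Finset.mem_range.2 (Nat.lt_succ_of_le h3), ?_⟩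
    rw [Encodable.encodek]
    simp only [Option.getD_some, S']
    rw [dif_pos h1]
    exact h1.1.mem_toFinset.2 (hN m h2)

lemma PP_cyl_le (σ : List ℕ) : PP (cyl_s13 σ) ≤ (2:ℝ≥0∞)⁻¹ ^ σ.length := by
  rw [PP_cyl]
  induction σ with
  | nil => simp
  | cons a l ih =>
    rw [List.map_cons, List.prod_cons, List.length_cons, pow_succ' (2:ℝ≥0∞)⁻¹]
    refine mul_le_mul' (ENNReal.inv_le_inv.2 ?_) ih
    exact le_self_pow₀ (by norm_num) (by simp)

lemma PP_singleton (x : Baire) : PP {x} = 0 := by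
  refine le_antisymm ?_ zero_le
  have ht : Tendsto (fun n : ℕ => (2:ℝ≥0∞)⁻¹ ^ n) atTop (nhds 0) :=
    ENNReal.tendsto_pow_atTop_nhds_zero_of_lt_one (by simp)
  refine ge_of_tendsto' ht fun n => ?_
  have h := PP_cyl_le ((List.range n).map x)
  simp only [List.length_map, List.length_range] at h
  refine (measure_mono ?_).trans h
  rw [cyl_map, Set.singleton_subset_iff]
  exact PiNat.self_mem_cylinder _ _

instance : NullSingletonClass PP := ⟨PP_singleton⟩

end meas

lemma card_of_not_countable {A : Set Baire} (hA : MeasurableSet A) (hc : ¬ A.Countable) :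
    #A = #Baire := by
  have := hA.standardBorel
  have e := PolishSpace.measurableEquivNatBoolOfNotCountable (α := A) hc
  rw [Cardinal.mk_congr e.toEquiv]
  simp

lemma null_card {A : Set Baire} (hA : PP A = 0) : #(Aᶜ : Set Baire) = #Baire := by
  refine le_antisymm (Cardinal.mk_set_le _) ?_
  have h := card_of_not_countable (A := (toMeasurable PP A)ᶜ) (measurableSet_toMeasurable _ _).compl ?_
  · rw [← h]
    exact Cardinal.mk_le_mk_of_subset (Set.compl_subset_compl.2 (subset_toMeasurable _ _))
  · intro hc
    have h1 := hc.measure_zero PP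
    rw [prob_compl_eq_zero_iff (measurableSet_toMeasurable _ _), measure_toMeasurable, hA] at h1
    exact zero_ne_one h1

lemma singleton_meagre (x : Baire) : IsMeagre ({x} : Set Baire) := by
  unfold IsMeagre
  refine residual_of_dense_open isOpen_compl_singleton ?_
  rw [dense_iff_inter_open]
  rintro V hV ⟨y, hy⟩
  obtain ⟨n, -, hn⟩ := exists_cyl hV hy 0
  rw [cyl_map] at hn
  refine ⟨Function.update y n (x n + 1), hn ?_, ?_⟩
  · exact PiNat.update_mem_cylinder _ _ _
  · intro h
    have := congrFun (Set.mem_singleton_iff.1 h) n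
    simp at this

lemma meagre_countable {A : Set Baire} (hA : A.Countable) : IsMeagre A := by
  rw [← Set.biUnion_of_singleton A]
  exact isMeagre_biUnion hA fun x _ => singleton_meagre x

lemma meagre_card {A : Set Baire} (hA : IsMeagre A) : #(Aᶜ : Set Baire) = #Baire := by
  refine le_antisymm (Cardinal.mk_set_le _) ?_
  obtain ⟨t, htA, htG, htd⟩ := mem_residual.1 hA
  have h := card_of_not_countable (A := t) htG.measurableSet ?_
  · rw [← h]
    exact Cardinal.mk_le_mk_of_subset htA
  · intro hc
    have h1 := meagre_countable hc
    have h2 : tᶜ ∩ t ∈ residual Baire := inter_mem h1 (residual_of_dense_Gδ htG htd)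
    rw [Set.compl_inter_self] at h2
    exact (dense_of_mem_residual h2).nonempty.ne_empty rfl

lemma add_prop {ι : Type} (A : ι → Set Baire) (hι : #ι < addNull PP) (hA : ∀ i, PP (A i) = 0) :
    PP (⋃ i, A i) = 0 := by
  by_contra hne
  have : addNull PP ≤ #(Set.range A) := by
    refine csInf_le' ⟨Set.range A, rfl, ?_, ?_⟩
    · rintro _ ⟨i, rfl⟩; exact hA i
    · rwa [Set.sUnion_range]
  exact absurd hι (not_lt.2 (this.trans Cardinal.mk_range_le))

lemma aleph0_le_add : ℵ₀ ≤ addNull PP := by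
  refine le_csInf ?_ ?_
  · refine ⟨_, Set.range (fun x : Baire => ({x} : Set Baire)), rfl, ?_, ?_⟩
    · rintro _ ⟨i, rfl⟩; exact PP_singleton i
    · rw [Set.sUnion_range, Set.iUnion_of_singleton, measure_univ]
      exact one_ne_zero
  · rintro _ ⟨S, rfl, hS, hne⟩
    by_contra hlt
    have hc : S.Countable := Cardinal.le_aleph0_iff_set_countable.1 (not_le.1 hlt).le
    exact hne ((measure_sUnion_null_iff hc).2 hS)

lemma exists_s {T : Type} [LinearOrder T] [WellFoundedLT T] (N M : T → Set Baire)
    (I J : Set (Set Baire)) (hN : ∀ t, N t ∈ I) (hNc : ∀ A ∈ I, ∃ t, A ⊆ N t) (hNm : Monotone N)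
    (hcard : ∀ A ∈ I, #(Aᶜ : Set Baire) = #Baire) (hM : ∀ t, M t ∈ J) (hMm : Monotone M)
    (hMcov : ∀ y, ∃ t, y ∈ M t) (hJ : ∀ A B : Set Baire, A ⊆ B → B ∈ J → A ∈ J) :
    ∃ s : Baire → Baire, Function.Injective s ∧ ∀ A ∈ I, s ⁻¹' A ∈ J := by
  have hρ : ∀ y, ∃ t, y ∈ M t ∧ ∀ t', y ∈ M t' → t ≤ t' := by
    intro y
    have hne : {t | y ∈ M t}.Nonempty := hMcov y
    exact ⟨wellFounded_lt.min _ hne, wellFounded_lt.min_mem _ hne,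
      fun t' ht' => not_lt.1 (wellFounded_lt.not_lt_min {t | y ∈ M t} ht')⟩
  choose ρ hρ1 hρ2 using hρ
  obtain ⟨s, hs, hsP⟩ := exists_inj (fun y => (N (ρ y))ᶜ) fun y => hcard _ (hN _)
  refine ⟨s, hs, fun A hA => ?_⟩
  obtain ⟨β, hβ⟩ := hNc A hA
  refine hJ _ (M β) (fun y hy => ?_) (hM β)
  have : ρ y < β := by
    by_contra hlt
    exact hsP y (hNm (not_lt.1 hlt) (hβ hy))
  exact hMm this.le (hρ1 y)

lemma exists_tower {T : Type} [LinearOrder T] [WellFoundedLT T] (hT : ∀ t : T, #(Set.Iic t) < #T)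
    (I : Set (Set Baire)) (hadd : ∀ {ι : Type} (A : ι → Set Baire), #ι < #T → (∀ i, A i ∈ I) → (⋃ i, A i) ∈ I)
    (B : T → Set Baire) (hB : ∀ t, B t ∈ I) (hc : ∀ A ∈ I, ∃ t, A ⊆ B t) :
    ∃ N : T → Set Baire, (∀ t, N t ∈ I) ∧ (∀ A ∈ I, ∃ t, A ⊆ N t) ∧ Monotone N := by
  refine ⟨fun t => ⋃ s : Set.Iic t, B s, fun t => hadd _ (hT t) fun s => hB _, fun A hA => ?_, ?_⟩
  · obtain ⟨t, ht⟩ := hc A hA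
    exact ⟨t, ht.trans (Set.subset_iUnion (fun s : Set.Iic t => B s) ⟨t, le_rfl⟩)⟩
  · intro a b hab
    refine Set.iUnion_subset fun s => ?_
    exact Set.subset_iUnion (fun s : Set.Iic b => B s) ⟨s.1, s.2.trans hab⟩

lemma bMod_aux {Y Z : Type} (I J : Set (Set Baire)) (R : Y → Z → Prop)
    (s : Baire → Baire) (hs : Function.Injective s) (hIJ : ∀ A ∈ I, s ⁻¹' A ∈ J) :
    (∀ A : Set (Baire → Y), (¬ ∃ g : Baire → Z, ∀ f ∈ A, RelMod J R f g) →
      ∃ A' : Set (Baire → Y), #A' ≤ #A ∧ ¬ ∃ g : Baire → Z, ∀ f ∈ A', RelMod I R f g) ∧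
    (∀ A : Set (Baire → Z), (∀ f : Baire → Y, ∃ g ∈ A, RelMod I R f g) →
      ∃ A' : Set (Baire → Z), #A' ≤ #A ∧ ∀ f : Baire → Y, ∃ g ∈ A', RelMod J R f g) := by
  have key : ∀ (f : Baire → Y) (g : Baire → Z), RelMod I R (f ∘ Function.invFun s) g →
      RelMod J R f (g ∘ s) := by
    intro f g h
    have := hIJ _ h
    unfold RelMod
    convert this using 1
    ext y
    simp [Function.leftInverse_invFun hs y]
  constructor
  · intro A hA
    refine ⟨(fun f => f ∘ Function.invFun s) '' A, Cardinal.mk_image_le, ?_⟩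
    rintro ⟨g, hg⟩
    exact hA ⟨g ∘ s, fun f hf => key f g (hg _ ⟨f, hf, rfl⟩)⟩
  · intro A hA
    refine ⟨(fun g => g ∘ s) '' A, Cardinal.mk_image_le, fun f => ?_⟩
    obtain ⟨g, hg, h⟩ := hA (f ∘ Function.invFun s)
    exact ⟨_, ⟨g, hg, rfl⟩, key f g h⟩

lemma sInf_eq_aux (A B : Set Cardinal.{0}) (h1 : ∀ c ∈ A, ∃ d ∈ B, d ≤ c)
    (h2 : ∀ c ∈ B, ∃ d ∈ A, d ≤ c) : sInf A = sInf B := by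
  rcases A.eq_empty_or_nonempty with rfl | hA
  · rcases B.eq_empty_or_nonempty with rfl | ⟨b, hb⟩
    · rfl
    · obtain ⟨d, hd, -⟩ := h2 b hb
      exact hd.elim
  · have hB : B.Nonempty := by
      obtain ⟨a, ha⟩ := hA
      obtain ⟨d, hd, -⟩ := h1 a ha
      exact ⟨d, hd⟩
    apply le_antisymm
    · refine le_csInf hB fun c hc => ?_
      obtain ⟨d, hd, hle⟩ := h2 c hc
      exact (csInf_le' hd).trans hle
    · refine le_csInf hA fun c hc => ?_
      obtain ⟨d, hd, hle⟩ := h1 c hc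
      exact (csInf_le' hd).trans hle

lemma mod_eq {Y Z : Type} (I J : Set (Set Baire)) (R : Y → Z → Prop)
    (hIJ : ∃ s : Baire → Baire, Function.Injective s ∧ ∀ A ∈ I, s ⁻¹' A ∈ J)
    (hJI : ∃ s : Baire → Baire, Function.Injective s ∧ ∀ A ∈ J, s ⁻¹' A ∈ I) :
    bMod I R = bMod J R ∧ dMod I R = dMod J R := by
  obtain ⟨s, hs, h1⟩ := hIJ
  obtain ⟨s', hs', h2⟩ := hJI
  have a := bMod_aux I J R s hs h1
  have b := bMod_aux J I R s' hs' h2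
  constructor
  · apply sInf_eq_aux
    · rintro _ ⟨A, rfl, hA⟩
      obtain ⟨A', hle, hA'⟩ := b.1 A hA
      exact ⟨_, ⟨A', rfl, hA'⟩, hle⟩
    · rintro _ ⟨A, rfl, hA⟩
      obtain ⟨A', hle, hA'⟩ := a.1 A hA
      exact ⟨_, ⟨A', rfl, hA'⟩, hle⟩
  · apply sInf_eq_aux
    · rintro _ ⟨A, rfl, hA⟩
      obtain ⟨A', hle, hA'⟩ := a.2 A hA
      exact ⟨_, ⟨A', rfl, hA'⟩, hle⟩
    · rintro _ ⟨A, rfl, hA⟩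
      obtain ⟨A', hle, hA'⟩ := b.2 A hA
      exact ⟨_, ⟨A', rfl, hA'⟩, hle⟩

lemma meagre_add {ι : Type} (A : ι → Set Baire) (hι : #ι < addNull PP) (hA : ∀ i, IsMeagre (A i)) :
    IsMeagre (⋃ i, A i) := by
  choose G hG using fun i => L2 hh (hA i)
  obtain ⟨S, hS, hSf⟩ := L1 (add_prop (fun i => Nf (G i)) hι fun i => Nf_null _)
  have hg : ∀ i, ∀ᶠ n in atTop, G i n ≤ (S n).sup id := by
    intro i
    filter_upwards [hSf (G i) (Set.subset_iUnion (fun i => Nf (G i)) i)] with n hn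
    exact Finset.le_sup (f := id) hn
  choose f hf using fun i => hG i _ (hg i)
  obtain ⟨S', hS', hSf'⟩ := L1 (add_prop (fun i => Nf (f i)) hι fun i => Nf_null _)
  refine (MM_meagre hh (fun n => (S n).sup id) S').mono (Set.iUnion_subset fun i => ?_)
  exact hf i S' hS' (hSf' (f i) (Set.subset_iUnion (fun i => Nf (f i)) i))

lemma meagre_cof {T : Type} (B : T → Set Baire) (hB : ∀ t, PP (B t) = 0)
    (hc : ∀ A, PP A = 0 → ∃ t, A ⊆ B t) :
    ∃ M : T × T → Set Baire, (∀ t, IsMeagre (M t)) ∧ ∀ A, IsMeagre A → ∃ t, A ⊆ M t := by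
  choose S hS hSf using fun t => L1 (hB t)
  refine ⟨fun p => MM hh (fun n => (S p.1 n).sup id) (S p.2), fun p => MM_meagre _ _ _, fun A hA => ?_⟩
  obtain ⟨G, hG⟩ := L2 hh hA
  obtain ⟨t, ht⟩ := hc _ (Nf_null G)
  have hg : ∀ᶠ n in atTop, G n ≤ (S t n).sup id := by
    filter_upwards [hSf t G ht] with n hn
    exact Finset.le_sup (f := id) hn
  obtain ⟨f, hf⟩ := hG _ hg
  obtain ⟨t', ht'⟩ := hc _ (Nf_null f)
  exact ⟨(t, t'), hf (S t') (hS t') (hSf t' f ht')⟩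

lemma main_aux (h : addNull PP = cofNull PP) :
    (∃ s : Baire → Baire, Function.Injective s ∧ ∀ A ∈ NullIdeal PP, s ⁻¹' A ∈ MeagerIdeal) ∧
    (∃ s : Baire → Baire, Function.Injective s ∧ ∀ A ∈ MeagerIdeal, s ⁻¹' A ∈ NullIdeal PP) := by
  obtain ⟨B, hBc, hB0, hBcof⟩ : cofNull PP ∈ {c : Cardinal | ∃ B : Set (Set Baire), #B = c ∧
      (∀ A ∈ B, PP A = 0) ∧ ∀ A : Set Baire, PP A = 0 → ∃ B' ∈ B, A ⊆ B'} :=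
    csInf_mem ⟨_, {A | PP A = 0}, rfl, fun A hA => hA, fun A hA => ⟨A, hA, subset_rfl⟩⟩
  let T : Type := (cofNull PP).ord.ToType
  have hT : #T = cofNull PP := Cardinal.mk_ord_toType _
  have hTa : #T = addNull PP := hT.trans h.symm
  have hinf : ℵ₀ ≤ #T := by rw [hTa]; exact aleph0_le_add
  have hIic : ∀ t : T, #(Set.Iic t) < #T := fun t =>
    Cardinal.mk_Iic_lt t (by rw [hT]; exact (Ordinal.type_toType _).symm) hinf
  obtain ⟨e⟩ : Nonempty (T ≃ B) := Cardinal.eq.1 (hT.trans hBc.symm)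
  obtain ⟨e2⟩ : Nonempty (T ≃ T × T) := Cardinal.eq.1 (by
    rw [Cardinal.mk_prod, Cardinal.lift_id, Cardinal.mul_eq_self hinf])
  have hcofB : ∀ A, PP A = 0 → ∃ t, A ⊆ (e t).1 := by
    intro A hA
    obtain ⟨B', hB', hsub⟩ := hBcof A hA
    exact ⟨e.symm ⟨B', hB'⟩, by simpa using hsub⟩
  obtain ⟨M0, hM0, hM0c⟩ := meagre_cof (fun t => (e t).1) (fun t => hB0 _ (e t).2) hcofB
  obtain ⟨N, hN, hNc, hNm⟩ := exists_tower hIic (NullIdeal PP)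
    (fun A hι hA => add_prop A (hTa ▸ hι) hA) (fun t => (e t).1) (fun t => hB0 _ (e t).2) hcofB
  obtain ⟨M, hM, hMc, hMm⟩ := exists_tower hIic MeagerIdeal
    (fun A hι hA => meagre_add A (hTa ▸ hι) hA) (fun t => M0 (e2 t)) (fun t => hM0 _) (by
      intro A hA
      obtain ⟨p, hp⟩ := hM0c A hA
      exact ⟨e2.symm p, by simpa using hp⟩)
  constructor
  · refine exists_s N M _ _ hN hNc hNm (fun A hA => null_card hA) hM hMm (fun y => ?_)
      fun A B hAB hB => IsMeagre.mono hAB hB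
    obtain ⟨t, ht⟩ := hMc {y} (singleton_meagre y)
    exact ⟨t, ht rfl⟩
  · refine exists_s M N _ _ hM hMc hMm (fun A hA => meagre_card hA) hN hNm (fun y => ?_)
      fun A B hAB hB => measure_mono_null hAB hB
    obtain ⟨t, ht⟩ := hNc {y} (PP_singleton y)
    exact ⟨t, ht rfl⟩

/-- if `add(N) = cof(N)` then for each `R ∈ {∈*, ≤*, ≠*}` we have
`𝔟(R_N) = 𝔟(R_M)` and `𝔡(R_N) = 𝔡(R_M)`. -/
theorem stmt_13 (μ : Measure Baire) (hμ : IsBaireProductMeasure μ)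
    (h : addNull μ = cofNull μ) :
    (bMod (NullIdeal μ) EvIn = bMod MeagerIdeal EvIn ∧
      dMod (NullIdeal μ) EvIn = dMod MeagerIdeal EvIn) ∧
    (bMod (NullIdeal μ) EvLE = bMod MeagerIdeal EvLE ∧
      dMod (NullIdeal μ) EvLE = dMod MeagerIdeal EvLE) ∧
    (bMod (NullIdeal μ) EvNE = bMod MeagerIdeal EvNE ∧
      dMod (NullIdeal μ) EvNE = dMod MeagerIdeal EvNE) := by
  obtain rfl := eq_PP hμ
  obtain ⟨h1, h2⟩ := main_aux h
  exact ⟨mod_eq _ _ _ h1 h2, mod_eq _ _ _ h1 h2, mod_eq _ _ _ h1 h2⟩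

end
end

section
/- Let (J_{n,k})_{n ∈ ℕ, 0 ≤ k < n} be a family of pairwise disjoint nonempty finite subsets of ℕ whose union is all of ℕ, and for each n set J_n = ⋃_{k < n} J_{n,k}. Let s be a J-slalom, i.e., a function assigning to each n ∈ ℕ a set s(n) of at most n functions each with domain J_n. Then there exists x_s : ℕ → ℕ such that for every y : ℕ → ℕ, if the restriction y↾J_n belongs to s(n) for all but finitely many n, then x_s(m) = y(m) for infinitely many m ∈ ℕ. -/
open Filter Cardinal MeasureTheory

noncomputable section

/-- given a partition `⟨J n k | k < n⟩` of `ℕ` into pairwise disjoint nonempty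
finite sets, with `Jl n = ⋃_{k<n} J n k`, and a `J`-slalom `s` (at most `n` functions with
domain `Jl n` at level `n`), there is `xs : ℕ → ℕ` agreeing infinitely often with every
`y : ℕ → ℕ` whose restrictions `y ↾ Jl n` are eventually captured by `s`. -/
theorem stmt_14 (J : ℕ → ℕ → Finset ℕ)
    (hne : ∀ n k, k < n → (J n k).Nonempty)
    (hdisj : ∀ n k n' k', k < n → k' < n' → (n, k) ≠ (n', k') →
      Disjoint (J n k) (J n' k'))
    (hcov : ∀ m : ℕ, ∃ n k, k < n ∧ m ∈ J n k)
    (s : (n : ℕ) → Finset ({m : ℕ // m ∈ (Finset.range n).biUnion (J n)} → ℕ))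
    (hs : ∀ n, (s n).card ≤ n) :
    ∃ xs : ℕ → ℕ, ∀ y : ℕ → ℕ,
      (∀ᶠ n in atTop,
        (fun m : {m : ℕ // m ∈ (Finset.range n).biUnion (J n)} => y m.1) ∈ s n) →
      ∃ᶠ m in atTop, xs m = y m := by
  classical
  choose nn kk hk hm using hcov
  have huniq : ∀ n k m, k < n → m ∈ J n k → nn m = n ∧ kk m = k := by
    intro n k m hkn hmem
    by_contra hcon
    have hd := hdisj (nn m) (kk m) n k (hk m) hkn (by
      intro h
      exact hcon ⟨congrArg Prod.fst h, congrArg Prod.snd h⟩)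
    exact (Finset.disjoint_left.mp hd (hm m)) hmem
  have hin : ∀ m, m ∈ (Finset.range (nn m)).biUnion (J (nn m)) := fun m =>
    Finset.mem_biUnion.mpr ⟨kk m, Finset.mem_range.mpr (hk m), hm m⟩
  refine ⟨fun m => ((s (nn m)).toList.getD (kk m) (fun _ => 0)) ⟨m, hin m⟩, ?_⟩
  intro y hy
  obtain ⟨N, hN⟩ := eventually_atTop.mp hy
  have key : ∀ n, N ≤ n → ∃ m, nn m = n ∧
      ((s (nn m)).toList.getD (kk m) (fun _ => 0)) ⟨m, hin m⟩ = y m := by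
    intro n hn
    have h1 := Finset.mem_toList.mpr (hN n hn)
    obtain ⟨k, hkl, hke⟩ := List.mem_iff_getElem.mp h1
    have hkn : k < n := by
      have h2 := hs n
      rw [Finset.length_toList] at hkl
      omega
    obtain ⟨m, hmem⟩ := hne n k hkn
    obtain ⟨e1, e2⟩ := huniq n k m hkn hmem
    refine ⟨m, e1, ?_⟩
    subst e1
    subst e2
    rw [List.getD_eq_getElem _ _ hkl, hke]
  choose! g hg1 hg2 using key
  rw [Nat.frequently_atTop_iff_infinite]
  refine Set.infinite_of_injOn_mapsTo (s := Set.Ici N) (f := g) ?_ ?_ (Set.Ici_infinite N)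
  · intro a ha b hb hab
    rw [← hg1 a ha, ← hg1 b hb, hab]
  · intro a ha
    exact hg2 a ha

end
end

section
/- Let x : ω₁ → (ℕ → ℕ) be a bijection from the countable ordinals onto Baire space (such a bijection exists exactly when the continuum hypothesis holds). Let N₀, N₁ : ω₁ → Set (ℕ → ℕ) be ω₁-sequences (possibly with repetitions) such that every N₀(α) and every N₁(α) is μ-null, and such that for every z : ℕ → ℕ the set of pairs (α, β) ∈ ω₁ × ω₁ with z ∉ N₀(α) ∪ N₁(β) is uncountable. Then there exist M₀, M₁ : ω₁ → Set (ℕ → ℕ) such that {(M₀(α), M₁(α)) : α < ω₁} = {(N₀(β), N₁(γ)) : β, γ < ω₁} as sets of pairs, and for every α < ω₁, x(α) ∉ M₀(α) ∪ M₁(α). -/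
open Filter Cardinal MeasureTheory

noncomputable section

/-- The countable ordinals, i.e. the ordinals below `ω₁`. -/
def Omega1 : Type 1 := {o : Ordinal // o < (Cardinal.aleph 1).ord}

/-- Injective choice from uncountable sets indexed by a type of size at most `ℵ₁`. -/
theorem inj_choice_s15 {P I : Type*} (hP : #P ≤ Cardinal.aleph 1) (S : P → Set I)
    (hS : ∀ p, ¬ (S p).Countable) : ∃ f : P → I, Function.Injective f ∧ ∀ p, f p ∈ S p := by
  obtain ⟨r, wo, hr⟩ := Cardinal.ord_eq P
  have hc : ∀ p, Set.Countable {q | r q p} := by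
    intro p
    have h1 : (Ordinal.typein r p) < (#P).ord := by
      rw [hr]; exact Ordinal.typein_lt_type r p
    have h2 : (Ordinal.typein r p).card < #P := Cardinal.lt_ord.1 h1
    rw [Ordinal.typein, ] at h2
    have h3 : #{q | r q p} < Cardinal.aleph 1 := lt_of_lt_of_le (by simp at h2; exact h2) hP
    rw [← Cardinal.le_aleph0_iff_set_countable, ← Order.lt_succ_iff, Cardinal.succ_aleph0]
    exact h3
  have key : ∀ (p : P) (g : ∀ q, r q p → I), ∃ i ∈ S p, ∀ q (hq : r q p), g q hq ≠ i := by
    intro p g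
    by_contra hcon
    push Not at hcon
    apply hS p
    have := (hc p).to_subtype
    refine (Set.countable_range (fun q : {q | r q p} => g q.1 q.2)).mono ?_
    intro i hi
    obtain ⟨q, hq, e⟩ := hcon i hi
    exact ⟨⟨q, hq⟩, e⟩
  choose F hF1 hF2 using key
  have wf : WellFounded r := wo.wf
  let f : P → I := wf.fix F
  have hf : ∀ p, f p = F p (fun q _ => f q) := fun p => wf.fix_eq F p
  have hlt : ∀ p q, r q p → f q ≠ f p := by
    intro p q hq
    rw [hf p]
    exact hF2 p (fun q _ => f q) q hq
  refine ⟨f, ?_, fun p => by rw [hf]; exact hF1 _ _⟩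
  intro p q e
  rcases trichotomous_of r p q with h | h | h
  · exact absurd e (hlt _ _ h)
  · exact h
  · exact absurd e.symm (hlt _ _ h)

theorem mk_Omega1 : #Omega1 = Cardinal.aleph 1 := by
  have := Cardinal.mk_Iio_ordinal (Cardinal.aleph 1).ord
  rw [Cardinal.card_ord, Cardinal.lift_aleph, Ordinal.lift_one] at this
  exact this

theorem null_singleton_s15 (μ : Measure Baire) (hμ : IsBaireProductMeasure μ) (z : Baire) :
    μ {z} = 0 := by
  have hb : ∀ n : ℕ, μ {z} ≤ ((2 : ENNReal)⁻¹) ^ n := by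
    intro n
    have h1 := hμ ((List.range n).map z)
    calc μ {z} ≤ _ := measure_mono (by
            rintro y rfl i
            simp)
      _ = _ := h1
      _ ≤ (2 : ENNReal)⁻¹ ^ n := by
        refine (List.prod_le_pow_card _ ((2 : ENNReal)⁻¹) ?_).trans (by simp)
        intro a ha
        simp only [List.mem_map] at ha
        obtain ⟨k, -, rfl⟩ := ha
        rw [ENNReal.inv_le_inv, pow_succ]
        exact le_mul_of_one_le_left (zero_le) (one_le_pow₀ (by norm_num))
  have ht := ENNReal.tendsto_pow_atTop_nhds_zero_of_lt_one (r := (2 : ENNReal)⁻¹) (by simp)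
  exact le_antisymm (ge_of_tendsto' ht hb) (zero_le)

theorem compl_unc (μ : Measure Baire) (hμ : IsBaireProductMeasure μ) (A : Set Baire)
    (hA : μ A = 0) : ¬ (Aᶜ).Countable := by
  intro hc
  have : μ Aᶜ = 0 := by
    rw [← Set.biUnion_of_singleton Aᶜ, measure_biUnion_null_iff hc]
    exact fun z _ => null_singleton_s15 μ hμ z
  have h1 := hμ []
  have h2 : μ (A ∪ Aᶜ) = 0 := measure_union_null hA this
  rw [Set.union_compl_self] at h2
  simp [h2] at h1

/-- given a bijective enumeration `x` of Baire space in order type `ω₁` and two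
`ω₁`-sequences `N₀`, `N₁` of `μ`-null sets such that every `z` avoids `N₀ α ∪ N₁ β` for
uncountably many pairs `(α, β)`, the pairs `(N₀ β, N₁ γ)` can be re-enumerated as
`⟨(M₀ α, M₁ α) | α < ω₁⟩` with `x α ∉ M₀ α ∪ M₁ α` for every `α`. -/
theorem stmt_15 (μ : Measure Baire) (hμ : IsBaireProductMeasure μ)
    (x : Omega1 → Baire) (hx : Function.Bijective x)
    (N₀ N₁ : Omega1 → Set Baire)
    (hN₀ : ∀ α, μ (N₀ α) = 0) (hN₁ : ∀ α, μ (N₁ α) = 0)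
    (h : ∀ z : Baire, ¬ Set.Countable {p : Omega1 × Omega1 | z ∉ N₀ p.1 ∪ N₁ p.2}) :
    ∃ M₀ M₁ : Omega1 → Set Baire,
      Set.range (fun α => (M₀ α, M₁ α)) =
        {p : Set Baire × Set Baire | ∃ β γ, p = (N₀ β, N₁ γ)} ∧
      ∀ α, x α ∉ M₀ α ∪ M₁ α := by
  obtain ⟨f, hf, hfS⟩ := inj_choice_s15 (P := Omega1 × Omega1) (I := Omega1)
    (by rw [Cardinal.mk_prod, Cardinal.lift_id, mk_Omega1,
          Cardinal.mul_eq_self (Cardinal.aleph0_le_aleph 1)])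
    (fun p => {α | x α ∉ N₀ p.1 ∪ N₁ p.2})
    (by
      intro p hc
      apply compl_unc μ hμ (N₀ p.1 ∪ N₁ p.2) (measure_union_null (hN₀ _) (hN₁ _))
      refine (hc.image x).mono ?_
      intro z hz
      obtain ⟨α, rfl⟩ := hx.2 z
      exact ⟨α, hz, rfl⟩)
  have hg : ∀ α, ∃ p : Omega1 × Omega1, x α ∉ N₀ p.1 ∪ N₁ p.2 ∧ ∀ q, f q = α → p = q := by
    intro α
    by_cases hα : ∃ q, f q = α
    · obtain ⟨q, rfl⟩ := hα
      exact ⟨q, hfS q, fun q' e => (hf e).symm⟩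
    · have : Set.Nonempty {p : Omega1 × Omega1 | x α ∉ N₀ p.1 ∪ N₁ p.2} := by
        by_contra hne
        rw [Set.not_nonempty_iff_eq_empty] at hne
        exact h (x α) (by rw [hne]; exact Set.countable_empty)
      obtain ⟨p, hp⟩ := this
      exact ⟨p, hp, fun q e => absurd ⟨q, e⟩ hα⟩
  choose g hg1 hg2 using hg
  refine ⟨fun α => N₀ (g α).1, fun α => N₁ (g α).2, ?_, hg1⟩
  ext s
  constructor
  · rintro ⟨α, rfl⟩
    exact ⟨_, _, rfl⟩
  · rintro ⟨β, γ, rfl⟩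
    refine ⟨f (β, γ), ?_⟩
    have := hg2 (f (β, γ)) (β, γ) rfl
    simp only [this]

end
end

section
/- Let D_N be the set of pairs (p, F) where p is a partial function from ℕ → ℕ to ℕ → ℕ with Borel graph and μ-null domain, and F is a countable set of functions (ℕ → ℕ) → (ℕ → ℕ); order it by (p, F) ≤ (q, G) iff p extends q, G ⊆ F, and for every x ∈ dom(p) \ dom(q) and every g ∈ G, g(x) ≤* p(x). Then: (a) D_N is σ-closed (every decreasing ω-sequence has a lower bound); (b) any two conditions with the same first component (stem) are compatible, and consequently every antichain in D_N has cardinality at most 𝔠; and (c) for every condition (p, F) ∈ D_N and every x ∉ dom(p) there is y : ℕ → ℕ such that (p ∪ {(x, y)}, F) is a condition extending (p, F). -/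
open Filter Cardinal MeasureTheory

noncomputable section

/-- `p ⊆ Baire × Baire` is the graph of a partial function. -/
def IsPFunGraph (p : Set (Baire × Baire)) : Prop :=
  ∀ x y y' : Baire, (x, y) ∈ p → (x, y') ∈ p → y = y'

/-- The domain of (the graph of) a partial function. -/
def pDom (p : Set (Baire × Baire)) : Set Baire := {x : Baire | ∃ y : Baire, (x, y) ∈ p}

/-- The conditions of the forcing `D_N`: pairs `(p, F)` with `p` a partial function from
Baire space to Baire space with Borel graph and `μ`-null domain, and `F` a countable set of
functions `Baire → Baire`. -/
def DNCond (μ : Measure Baire) : Set (Set (Baire × Baire) × Set (Baire → Baire)) :=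
  {d | IsPFunGraph d.1 ∧ MeasurableSet d.1 ∧ μ (pDom d.1) = 0 ∧ d.2.Countable}

/-- The extension relation of `D_N`: `(p, F) ≤ (q, G)` iff `p ⊇ q`, `F ⊇ G`, and for every
`x ∈ dom p \ dom q` and every `g ∈ G`, `g x ≤* p x`. -/
def DNle (d e : Set (Baire × Baire) × Set (Baire → Baire)) : Prop :=
  e.1 ⊆ d.1 ∧ e.2 ⊆ d.2 ∧
    ∀ x y : Baire, (x, y) ∈ d.1 → x ∉ pDom e.1 → ∀ g ∈ e.2, EvLE (g x) y

theorem aux_trans {a b c : Set (Baire × Baire) × Set (Baire → Baire)}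
    (ha : IsPFunGraph a.1) (h1 : DNle a b) (h2 : DNle b c) : DNle a c := by
  refine ⟨h2.1.trans h1.1, h2.2.1.trans h1.2.1, ?_⟩
  intro x y hxy hx g hg
  by_cases hb : x ∈ pDom b.1
  · obtain ⟨y', hy'⟩ := hb
    obtain rfl := ha x y y' hxy (h1.1 hy')
    exact h2.2.2 x y hy' hx g hg
  · exact h1.2.2 x y hxy hb g (h2.2.1 hg)

theorem aux_refl (a : Set (Baire × Baire) × Set (Baire → Baire)) : DNle a a :=
  ⟨subset_rfl, subset_rfl, fun _ y hxy hx => (hx ⟨y, hxy⟩).elim⟩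

theorem aux_mono {μ : Measure Baire} {d : ℕ → Set (Baire × Baire) × Set (Baire → Baire)}
    (hd : ∀ n, d n ∈ DNCond μ) (h : ∀ n, DNle (d (n + 1)) (d n)) {n m : ℕ} (hnm : n ≤ m) :
    DNle (d m) (d n) := by
  induction m, hnm using Nat.le_induction with
  | base => exact aux_refl _
  | succ m _ ih => exact aux_trans (hd _).1 (h m) ih

theorem aux_compat {μ : Measure Baire} {d e : Set (Baire × Baire) × Set (Baire → Baire)}
    (hd : d ∈ DNCond μ) (he : e ∈ DNCond μ) (h : d.1 = e.1) :
    ∃ r ∈ DNCond μ, DNle r d ∧ DNle r e := by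
  refine ⟨(d.1, d.2 ∪ e.2), ⟨hd.1, hd.2.1, hd.2.2.1, hd.2.2.2.union he.2.2.2⟩,
    ⟨subset_rfl, Set.subset_union_left, ?_⟩, ⟨h.symm.subset, Set.subset_union_right, ?_⟩⟩
  · intro x y hxy hx
    exact (hx ⟨y, hxy⟩).elim
  · intro x y hxy hx
    exact (hx ⟨y, h ▸ hxy⟩).elim

theorem aux_card : #{t : Set (Baire × Baire) | MeasurableSet t} ≤ Cardinal.continuum := by
  obtain ⟨b, hb, hb'⟩ :=
    (inferInstance : MeasurableSpace.CountablyGenerated (Baire × Baire)).isCountablyGenerated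
  rw [hb']
  exact MeasurableSpace.cardinal_measurableSet_le_continuum
    (hb.le_aleph0.trans aleph0_le_continuum)

theorem aux_singleton {μ : Measure Baire} (hμ : IsBaireProductMeasure μ) (x : Baire) :
    μ {x} = 0 := by
  have key : ∀ n : ℕ, μ {x} ≤ (2⁻¹ : ENNReal) ^ n := by
    intro n
    have h1 := hμ (List.ofFn fun i : Fin n => x i)
    have h2 : μ {x} ≤ μ {z : Baire | ∀ i : Fin (List.ofFn fun i : Fin n => x i).length,
        z i = (List.ofFn fun i : Fin n => x i).get i} := by
      apply measure_mono
      rintro z rfl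
      intro i
      simp
    refine h2.trans (h1.le.trans ?_)
    rw [List.map_ofFn, List.prod_ofFn]
    calc _ ≤ ∏ _i : Fin n, (2⁻¹ : ENNReal) := by
          refine Finset.prod_le_prod' fun i _ => ?_
          simp only [Function.comp]
          rw [ENNReal.inv_le_inv]
          exact le_self_pow₀ (by norm_num) (by simp)
      _ = _ := by simp
  have h0 : Tendsto (fun n : ℕ => (2⁻¹ : ENNReal) ^ n) atTop (nhds 0) :=
    ENNReal.tendsto_pow_atTop_nhds_zero_of_lt_one (by simp)
  exact le_antisymm (ge_of_tendsto' h0 key) zero_le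

theorem aux_dom {F : Set (Baire → Baire)} (hF : F.Countable) (x : Baire) :
    ∃ y : Baire, ∀ g ∈ F, EvLE (g x) y := by
  obtain ⟨f, hf⟩ := (hF.insert (fun _ _ => 0)).exists_eq_range (Set.insert_nonempty _ _)
  refine ⟨fun n => (Finset.range (n + 1)).sup fun i => f i x n, ?_⟩
  intro g hg
  obtain ⟨i, rfl⟩ : g ∈ Set.range f := hf ▸ Set.mem_insert_of_mem _ hg
  filter_upwards [eventually_ge_atTop i] with n hn
  exact Finset.le_sup (f := fun i => f i x n) (Finset.mem_range.2 (by omega))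

/-- (a) `D_N` is σ-closed; (b) two conditions with the same stem are
compatible, and consequently every antichain of `D_N` has cardinality at most `𝔠`;
(c) the stem of any condition can be extended to any `x` outside its domain. -/
theorem stmt_17 (μ : Measure Baire) (hμ : IsBaireProductMeasure μ) :
    (∀ d : ℕ → Set (Baire × Baire) × Set (Baire → Baire),
      (∀ n, d n ∈ DNCond μ) → (∀ n, DNle (d (n + 1)) (d n)) →
      ∃ e ∈ DNCond μ, ∀ n, DNle e (d n)) ∧
    ((∀ d ∈ DNCond μ, ∀ e ∈ DNCond μ, d.1 = e.1 →
        ∃ r ∈ DNCond μ, DNle r d ∧ DNle r e) ∧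
      ∀ A : Set (Set (Baire × Baire) × Set (Baire → Baire)), A ⊆ DNCond μ →
        (∀ d ∈ A, ∀ e ∈ A, d ≠ e → ¬ ∃ r ∈ DNCond μ, DNle r d ∧ DNle r e) →
        #A ≤ Cardinal.continuum) ∧
    ∀ d ∈ DNCond μ, ∀ x : Baire, x ∉ pDom d.1 →
      ∃ y : Baire, (insert (x, y) d.1, d.2) ∈ DNCond μ ∧
        DNle (insert (x, y) d.1, d.2) d := by
  refine ⟨?_, ⟨fun d hd e he h => aux_compat hd he h, ?_⟩, ?_⟩
  · intro d hd h
    refine ⟨(⋃ n, (d n).1, ⋃ n, (d n).2), ⟨?_, ?_, ?_, ?_⟩, ?_⟩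
    · intro x y y' hy hy'
      obtain ⟨n, hn⟩ := Set.mem_iUnion.1 hy
      obtain ⟨m, hm⟩ := Set.mem_iUnion.1 hy'
      exact (hd (max n m)).1 x y y' ((aux_mono hd h (le_max_left n m)).1 hn)
        ((aux_mono hd h (le_max_right n m)).1 hm)
    · exact MeasurableSet.iUnion fun n => (hd n).2.1
    · refine measure_mono_null ?_ (measure_iUnion_null fun n => (hd n).2.2.1)
      rintro x ⟨y, hy⟩
      obtain ⟨n, hn⟩ := Set.mem_iUnion.1 hy
      exact Set.mem_iUnion.2 ⟨n, y, hn⟩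
    · exact Set.countable_iUnion fun n => (hd n).2.2.2
    · intro n
      refine ⟨Set.subset_iUnion (fun n => (d n).1) n, Set.subset_iUnion (fun n => (d n).2) n, ?_⟩
      intro x y hxy hx g hg
      obtain ⟨m, hm⟩ := Set.mem_iUnion.1 hxy
      rcases le_total n m with hnm | hnm
      · exact (aux_mono hd h hnm).2.2 x y hm hx g hg
      · exact (hx ⟨y, (aux_mono hd h hnm).1 hm⟩).elim
  · intro A hA hanti
    refine le_trans ?_ aux_card
    refine Cardinal.mk_le_of_injective
      (f := fun a : A => (⟨a.1.1, (hA a.2).2.1⟩ : {t : Set (Baire × Baire) | MeasurableSet t})) ?_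
    intro a b hab
    by_contra hne
    exact hanti a.1 a.2 b.1 b.2 (fun h => hne (Subtype.ext h))
      (aux_compat (hA a.2) (hA b.2) (congrArg Subtype.val hab))
  · intro d hd x hx
    obtain ⟨y, hy⟩ := aux_dom hd.2.2.2 x
    refine ⟨y, ⟨?_, ?_, ?_, hd.2.2.2⟩, Set.subset_insert _ _, subset_rfl, ?_⟩
    · intro a b b' hb hb'
      rcases hb with hb | hb <;> rcases hb' with hb' | hb'
      · rw [Prod.mk.injEq] at hb hb'
        rw [hb.2, hb'.2]
      · rw [Prod.mk.injEq] at hb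
        exact (hx ⟨b', hb.1 ▸ hb'⟩).elim
      · rw [Prod.mk.injEq] at hb'
        exact (hx ⟨b, hb'.1 ▸ hb⟩).elim
      · exact hd.1 a b b' hb hb'
    · exact hd.2.1.insert _
    · refine measure_mono_null (t := {x} ∪ pDom d.1) ?_
        (measure_union_null (aux_singleton hμ x) hd.2.2.1)
      rintro a ⟨b, hb | hb⟩
      · rw [Prod.mk.injEq] at hb
        exact Or.inl hb.1
      · exact Or.inr ⟨b, hb⟩
    · intro a b hab ha g hg
      rcases hab with hab | hab
      · rw [Prod.mk.injEq] at hab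
        rw [hab.1, hab.2]
        exact hy g hg
      · exact (ha ⟨b, hab⟩).elim

end
end

section
/- Let LOC_N be the set of pairs (p, F) where p is a partial function from ℕ → ℕ to slaloms with Borel graph and μ-null Borel domain, and F is a countable set of functions (ℕ → ℕ) → (ℕ → ℕ); order it by (p, F) ≤ (q, G) iff p extends q, G ⊆ F, and for every x ∈ dom(p) \ dom(q) and every g ∈ G, g(x) ∈* p(x). Then: (a) LOC_N is σ-closed (every decreasing ω-sequence has a lower bound); (b) any two conditions with the same first component are compatible, and consequently every antichain in LOC_N has cardinality at most 𝔠; and (c) for every condition (p, F) and every x ∉ dom(p) there is a slalom s with g(x) ∈* s for all g ∈ F, so that (p ∪ {(x, s)}, F) is a condition extending (p, F). -/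
open Filter Cardinal MeasureTheory

noncomputable section

instance : MeasurableSpace (Finset ℕ) := ⊤

instance : MeasurableSpace Slalom :=
  inferInstanceAs (MeasurableSpace {s : ℕ → Finset ℕ // ∀ n, (s n).card ≤ n})

/-- `p ⊆ Baire × Slalom` is the graph of a partial function into slaloms. -/
def IsPFunGraphS (p : Set (Baire × Slalom)) : Prop :=
  ∀ (x : Baire) (s s' : Slalom), (x, s) ∈ p → (x, s') ∈ p → s = s'

/-- The domain of (the graph of) a partial function into slaloms. -/
def pDomS (p : Set (Baire × Slalom)) : Set Baire := {x : Baire | ∃ s : Slalom, (x, s) ∈ p}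

/-- The conditions of the forcing `LOC_N`: pairs `(p, F)` with `p` a partial function from
Baire space to slaloms with Borel graph and `μ`-null Borel domain, and `F` a countable set
of functions `Baire → Baire`. -/
def LOCNCond (μ : Measure Baire) : Set (Set (Baire × Slalom) × Set (Baire → Baire)) :=
  {d | IsPFunGraphS d.1 ∧ MeasurableSet d.1 ∧
    MeasurableSet (pDomS d.1) ∧ μ (pDomS d.1) = 0 ∧ d.2.Countable}

/-- The extension relation of `LOC_N`: `(p, F) ≤ (q, G)` iff `p ⊇ q`, `F ⊇ G`, and for
every `x ∈ dom p \ dom q` and every `g ∈ G`, `g x ∈* p x`. -/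
def LOCNle (d e : Set (Baire × Slalom) × Set (Baire → Baire)) : Prop :=
  e.1 ⊆ d.1 ∧ e.2 ⊆ d.2 ∧
    ∀ (x : Baire) (s : Slalom), (x, s) ∈ d.1 → x ∉ pDomS e.1 → ∀ g ∈ e.2, EvIn (g x) s

theorem LOCNle_trans' {d e f : Set (Baire × Slalom) × Set (Baire → Baire)}
    (hd : IsPFunGraphS d.1) (h1 : LOCNle d e) (h2 : LOCNle e f) : LOCNle d f := by
  refine ⟨h2.1.trans h1.1, h2.2.1.trans h1.2.1, ?_⟩
  intro x s hs hx g hg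
  by_cases hxe : x ∈ pDomS e.1
  · obtain ⟨s', hs'⟩ := hxe
    obtain rfl := hd x s s' hs (h1.1 hs')
    exact h2.2.2 x s hs' hx g hg
  · exact h1.2.2 x s hs hxe g (h2.2.1 hg)

theorem LOCNle_refl' (d : Set (Baire × Slalom) × Set (Baire → Baire)) : LOCNle d d :=
  ⟨subset_rfl, subset_rfl, fun x s hs hx => absurd ⟨s, hs⟩ hx⟩

theorem baire_singleton_null (μ : Measure Baire) (hμ : IsBaireProductMeasure μ) (x : Baire) :
    μ {x} = 0 := by
  have key : ∀ n : ℕ, μ {x} ≤ (2⁻¹ : ENNReal) ^ n := by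
    intro n
    have h := hμ ((List.range n).map x)
    calc μ {x} ≤ _ := measure_mono (by
            rintro y rfl
            intro i
            simp)
      _ = _ := h
      _ ≤ (2⁻¹ : ENNReal) ^ n := by
        clear h
        induction n with
        | zero => simp
        | succ n ih =>
          rw [List.range_succ, List.map_append, List.map_append, List.prod_append, pow_succ]
          refine mul_le_mul' ih ?_
          simp only [List.map_cons, List.map_nil, List.prod_cons, List.prod_nil, mul_one]
          rw [ENNReal.inv_le_inv]
          exact le_self_pow₀ (by norm_num) (by omega)
  have ht : Tendsto (fun n : ℕ => (2⁻¹ : ENNReal) ^ n) atTop (nhds 0) :=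
    ENNReal.tendsto_pow_atTop_nhds_zero_of_lt_one (by norm_num)
  exact le_antisymm (ge_of_tendsto' ht key) zero_le

instance : MeasurableSpace.CountablyGenerated Slalom :=
  inferInstanceAs (MeasurableSpace.CountablyGenerated {s : ℕ → Finset ℕ // ∀ n, (s n).card ≤ n})

instance : MeasurableSingletonClass Slalom :=
  inferInstanceAs (MeasurableSingletonClass {s : ℕ → Finset ℕ // ∀ n, (s n).card ≤ n})

theorem exists_slalom (F : Set (Baire → Baire)) (hF : F.Countable) (x : Baire) :
    ∃ s : Slalom, ∀ g ∈ F, EvIn (g x) s := by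
  classical
  rcases F.eq_empty_or_nonempty with rfl | hne
  · exact ⟨⟨fun _ => ∅, by simp⟩, by simp⟩
  · obtain ⟨f, rfl⟩ := hF.exists_eq_range hne
    refine ⟨⟨fun n => (Finset.range n).image fun i => f i x n, fun n =>
      Finset.card_image_le.trans (by simp)⟩, ?_⟩
    rintro _ ⟨i, rfl⟩
    refine (eventually_gt_atTop i).mono fun n hn => ?_
    exact Finset.mem_image.2 ⟨i, Finset.mem_range.2 hn, rfl⟩

/-- (a) `LOC_N` is σ-closed; (b) two conditions with the same first component
are compatible, and consequently every antichain of `LOC_N` has cardinality at most `𝔠`;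
(c) the stem of any condition can be extended to any `x` outside its domain by a slalom
capturing `g x` for every `g` in the side part. -/
theorem stmt_18 (μ : Measure Baire) (hμ : IsBaireProductMeasure μ) :
    (∀ d : ℕ → Set (Baire × Slalom) × Set (Baire → Baire),
      (∀ n, d n ∈ LOCNCond μ) → (∀ n, LOCNle (d (n + 1)) (d n)) →
      ∃ e ∈ LOCNCond μ, ∀ n, LOCNle e (d n)) ∧
    ((∀ d ∈ LOCNCond μ, ∀ e ∈ LOCNCond μ, d.1 = e.1 →
        ∃ r ∈ LOCNCond μ, LOCNle r d ∧ LOCNle r e) ∧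
      ∀ A : Set (Set (Baire × Slalom) × Set (Baire → Baire)), A ⊆ LOCNCond μ →
        (∀ d ∈ A, ∀ e ∈ A, d ≠ e → ¬ ∃ r ∈ LOCNCond μ, LOCNle r d ∧ LOCNle r e) →
        #A ≤ Cardinal.continuum) ∧
    ∀ d ∈ LOCNCond μ, ∀ x : Baire, x ∉ pDomS d.1 →
      ∃ s : Slalom, (∀ g ∈ d.2, EvIn (g x) s) ∧
        (insert (x, s) d.1, d.2) ∈ LOCNCond μ ∧
        LOCNle (insert (x, s) d.1, d.2) d := by
  have hb : ∀ d ∈ LOCNCond μ, ∀ e ∈ LOCNCond μ, d.1 = e.1 →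
        ∃ r ∈ LOCNCond μ, LOCNle r d ∧ LOCNle r e := by
    rintro d ⟨h1, h2, h3, h4, h5⟩ e he hde
    refine ⟨(d.1, d.2 ∪ e.2), ⟨h1, h2, h3, h4, h5.union he.2.2.2.2⟩,
      ⟨subset_rfl, Set.subset_union_left, fun x s hs hx => absurd ⟨s, hs⟩ hx⟩,
      ⟨hde.ge, Set.subset_union_right, fun x s hs hx => absurd ⟨s, hde ▸ hs⟩ hx⟩⟩
  refine ⟨?_, ⟨hb, ?_⟩, ?_⟩
  · intro d hd hle
    have hmn : ∀ n m, n ≤ m → LOCNle (d m) (d n) := by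
      intro n m h
      induction m, h using Nat.le_induction with
      | base => exact LOCNle_refl' _
      | succ m _ ih => exact LOCNle_trans' (hd _).1 (hle m) ih
    have hdom : pDomS (⋃ n, (d n).1) = ⋃ n, pDomS (d n).1 := by
      ext x
      simp only [pDomS, Set.mem_ofPred_eq, Set.mem_iUnion]
      exact exists_comm
    refine ⟨(⋃ n, (d n).1, ⋃ n, (d n).2), ⟨?_, ?_, ?_, ?_, ?_⟩, ?_⟩
    · intro x s s' hs hs'
      obtain ⟨n, hn⟩ := Set.mem_iUnion.1 hs
      obtain ⟨m, hm⟩ := Set.mem_iUnion.1 hs'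
      exact (hd (max n m)).1 x s s' ((hmn n _ (le_max_left _ _)).1 hn)
        ((hmn m _ (le_max_right _ _)).1 hm)
    · exact MeasurableSet.iUnion fun n => (hd n).2.1
    · change MeasurableSet (pDomS (⋃ n, (d n).1))
      rw [hdom]
      exact MeasurableSet.iUnion fun n => (hd n).2.2.1
    · change μ (pDomS (⋃ n, (d n).1)) = 0
      rw [hdom]
      exact measure_iUnion_null fun n => (hd n).2.2.2.1
    · exact Set.countable_iUnion fun n => (hd n).2.2.2.2
    · intro n
      refine ⟨Set.subset_iUnion (fun n => (d n).1) n, Set.subset_iUnion (fun n => (d n).2) n, ?_⟩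
      intro x s hs hx g hg
      obtain ⟨m, hm⟩ := Set.mem_iUnion.1 hs
      exact (hmn n _ (le_max_left n m)).2.2 x s ((hmn m _ (le_max_right n m)).1 hm) hx g hg
  · intro A hA hanti
    obtain ⟨b, hbc, hbe⟩ :=
      MeasurableSpace.CountablyGenerated.isCountablyGenerated (α := Baire × Slalom)
    have hcard := MeasurableSpace.cardinal_measurableSet_le_continuum
      (hbc.le_aleph0.trans Cardinal.aleph0_le_continuum)
    rw [← hbe] at hcard
    refine le_trans ?_ hcard
    refine Cardinal.mk_le_of_injective
      (f := fun a : A => (⟨a.1.1, (hA a.2).2.1⟩ : {t : Set (Baire × Slalom) // MeasurableSet t})) ?_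
    intro a b hab
    by_contra hne
    exact hanti a.1 a.2 b.1 b.2 (fun h => hne (Subtype.ext h))
      (hb a.1 (hA a.2) b.1 (hA b.2) (congrArg Subtype.val hab))
  · rintro d ⟨h1, h2, h3, h4, h5⟩ x hx
    obtain ⟨s, hs⟩ := exists_slalom d.2 h5 x
    have hdom : pDomS (insert (x, s) d.1) = insert x (pDomS d.1) := by
      ext y
      constructor
      · rintro ⟨t, ht | ht⟩
        · exact Or.inl (congrArg Prod.fst ht)
        · exact Or.inr ⟨t, ht⟩
      · rintro (rfl | ⟨t, ht⟩)
        · exact ⟨s, Or.inl rfl⟩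
        · exact ⟨t, Or.inr ht⟩
    refine ⟨s, hs, ⟨?_, h2.insert _, ?_, ?_, h5⟩, Set.subset_insert _ _, subset_rfl, ?_⟩
    · rintro y t t' (ht | ht) (ht' | ht')
      · exact (congrArg Prod.snd ht).trans (congrArg Prod.snd ht').symm
      · obtain rfl : y = x := congrArg Prod.fst ht
        exact absurd ⟨t', ht'⟩ hx
      · obtain rfl : y = x := congrArg Prod.fst ht'
        exact absurd ⟨t, ht⟩ hx
      · exact h1 y t t' ht ht'
    · change MeasurableSet (pDomS (insert (x, s) d.1))
      rw [hdom]
      exact h3.insert x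
    · change μ (pDomS (insert (x, s) d.1)) = 0
      rw [hdom, Set.insert_eq]
      exact measure_union_null (baire_singleton_null μ hμ x) h4
    · rintro y t (ht | ht) hy g hg
      · obtain rfl : y = x := congrArg Prod.fst ht
        obtain rfl : t = s := congrArg Prod.snd ht
        exact hs g hg
      · exact absurd ⟨t, ht⟩ hy

end
end

section
/- Assume the continuum hypothesis (𝔠 = ℵ₁). Then for every uncountable Borel set B ⊆ ℕ → ℕ there exists a function f : (ℕ → ℕ) → (ℕ → ℕ) such that for every function g : (ℕ → ℕ) → (ℕ → ℕ) whose graph is a Borel subset of (ℕ → ℕ) × (ℕ → ℕ), there is an x ∈ B with ¬(f(x) ≤* g(x)); that is, no function with Borel graph dominates f at every point of B. -/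
open Filter Cardinal MeasureTheory

noncomputable section

/-- assuming CH, for every uncountable Borel set `B ⊆ Baire` there is an
`f : Baire → Baire` such that no `g : Baire → Baire` with Borel graph satisfies
`f x ≤* g x` at every point `x ∈ B`. -/
theorem stmt_19 (hCH : Cardinal.continuum = Cardinal.aleph 1)
    (B : Set Baire) (hBmeas : MeasurableSet B) (hBunc : ¬ B.Countable) :
    ∃ f : Baire → Baire, ∀ g : Baire → Baire,
      MeasurableSet {p : Baire × Baire | p.2 = g p.1} →
      ∃ x ∈ B, ¬ EvLE (f x) (g x) := by
  classical
  let G : Type := {g : Baire → Baire // MeasurableSet {p : Baire × Baire | p.2 = g p.1}}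
  obtain ⟨b, hbc, hb⟩ := (inferInstance :
    MeasurableSpace.CountablyGenerated (Baire × Baire)).isCountablyGenerated
  have h1 : #{t : Set (Baire × Baire) // MeasurableSet t} ≤ Cardinal.continuum := by
    rw [hb]
    exact MeasurableSpace.cardinal_measurableSet_le_continuum
      ((Cardinal.le_aleph0_iff_set_countable.2 hbc).trans Cardinal.aleph0_le_continuum)
  have h2 : #G ≤ #{t : Set (Baire × Baire) // MeasurableSet t} := by
    refine Cardinal.mk_le_of_injective
      (f := fun g : G => ⟨{p : Baire × Baire | p.2 = g.1 p.1}, g.2⟩) ?_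
    intro g h hgh
    apply Subtype.ext
    funext x
    have h3 : {p : Baire × Baire | p.2 = g.1 p.1} = {p : Baire × Baire | p.2 = h.1 p.1} :=
      congrArg Subtype.val hgh
    have h4 : (x, g.1 x) ∈ {p : Baire × Baire | p.2 = h.1 p.1} := by
      rw [← h3]
      rfl
    exact h4
  have h5 : Cardinal.continuum ≤ #B := by
    have hCH0 : Cardinal.continuum.{0} = Cardinal.aleph 1 := by
      apply Cardinal.lift_injective
      rw [Cardinal.lift_continuum, Cardinal.lift_aleph]
      simpa using hCH
    rw [hCH0, ← Cardinal.succ_aleph0, Order.succ_le_iff]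
    by_contra hlt
    exact hBunc (Cardinal.le_aleph0_iff_set_countable.1 (not_lt.1 hlt))
  obtain ⟨e⟩ : Nonempty (G ↪ B) := Cardinal.le_def _ _ |>.1 ((h2.trans h1).trans h5)
  refine ⟨fun x n => if h : ∃ g : G, (e g : Baire) = x then h.choose.1 x n + 1 else 0, ?_⟩
  intro g hg
  refine ⟨e ⟨g, hg⟩, (e ⟨g, hg⟩).2, ?_⟩
  intro hle
  have hex : ∃ g' : G, (e g' : Baire) = e ⟨g, hg⟩ := ⟨_, rfl⟩
  have hch : hex.choose = ⟨g, hg⟩ := e.injective (Subtype.ext hex.choose_spec)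
  obtain ⟨n, hn⟩ := hle.exists
  simp only [dif_pos hex, hch] at hn
  omega

end
end
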